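/- arXiv:1902.04847 — 4 statements merged into one kernel-verified Lean document; each statement's English description precedes it below -/
import Mathlib

section
/- If n ≥ 2 is prime and n ∉ {3, 5}, then the quotient algebra E = (A#C_n)/(e₀) is finite-dimensional as a k-vector space (i.e., n is admissible). -/
open scoped BigOperators

namespace NCIS

variable (k : Type*) [Field k] (n : ℕ)

/-- Relations defining the skew group algebra `A # C_n`, where
`A = k_{-1}[x_0, …, x_{n-1}]`: the generators are `x_i` (`Sum.inl i`) and `s` (`Sum.inr ()`),
subject to `x_i x_j + x_j x_i = 0` for `i ≠ j`, `s^n = 1` and `s x_i = x_{i+1} s`. -/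
inductive SGRel : FreeAlgebra k (ZMod n ⊕ Unit) → FreeAlgebra k (ZMod n ⊕ Unit) → Prop
  | anti (i j : ZMod n) (h : i ≠ j) :
      SGRel (FreeAlgebra.ι k (Sum.inl i) * FreeAlgebra.ι k (Sum.inl j)
           + FreeAlgebra.ι k (Sum.inl j) * FreeAlgebra.ι k (Sum.inl i)) 0
  | spow : SGRel (FreeAlgebra.ι k (Sum.inr ()) ^ n) 1
  | scomm (i : ZMod n) :
      SGRel (FreeAlgebra.ι k (Sum.inr ()) * FreeAlgebra.ι k (Sum.inl i))
            (FreeAlgebra.ι k (Sum.inl (i + 1)) * FreeAlgebra.ι k (Sum.inr ()))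

/-- The skew group algebra `A # C_n`. -/
abbrev SkewGroup := RingQuot (SGRel k n)

/-- The image of the generator `x_i` in `A # C_n`. -/
noncomputable def xg (i : ZMod n) : SkewGroup k n :=
  RingQuot.mkAlgHom k (SGRel k n) (FreeAlgebra.ι k (Sum.inl i))

/-- The image of the generator `s` in `A # C_n`. -/
noncomputable def sg : SkewGroup k n :=
  RingQuot.mkAlgHom k (SGRel k n) (FreeAlgebra.ι k (Sum.inr ()))

/-- The integral `e₀ = (1/n) ∑_{i=0}^{n-1} s^i` in `A # C_n`. -/
noncomputable def e0 : SkewGroup k n := (n : k)⁻¹ • ∑ i ∈ Finset.range n, sg k n ^ i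

/-- The quotient algebra `E = (A # C_n)/(e₀)` of `A # C_n` by the two-sided ideal
generated by `e₀`. -/
abbrev Equot := RingQuot (fun a b : SkewGroup k n => a = e0 k n ∧ b = 0)

end NCIS

/-- Expanding `c ^ r` along the pairs `y b, y (-b)` with `1 ≤ b ≤ r` gives a sum of products, each
of which is annihilated by `e t` for all `t` in an interval of length `1 + 2 + ⋯ + r`. -/
theorem pow_mem_closure_annihilated {R : Type*} [Ring R] (y e : ℤ → R) (c : R) (m : ℕ)
    (h_anti : ∀ a b : ℤ, |a| ≤ m → |b| ≤ m → a + b ≠ 0 → y a * y b = -(y b * y a))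
    (h_pair : ∀ a, y a * y (-a) + y (-a) * y a = c)
    (h_shift : ∀ t a, e t * y a = y a * e (t - a)) (h_zero : e 0 = 0)
    (r : ℕ) (hr : r ≤ m) :
    c ^ r ∈ AddSubmonoid.closure
      {P : R | (∀ b : ℤ, r < |b| → |b| ≤ m → Commute P (y b)) ∧
        ∃ l : ℤ, ∀ t, l ≤ t → t ≤ l + ∑ i ∈ Finset.range (r + 1), (i : ℤ) → e t * P = 0} := by
  induction r with
  | zero =>
    refine AddSubmonoid.subset_closure ⟨fun b _ _ => by simp, 0, fun t h1 h2 => ?_⟩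
    obtain rfl : t = 0 := by simp at h2; omega
    simp [h_zero]
  | succ r ih =>
    have h_tri : (r : ℤ) ≤ ∑ i ∈ Finset.range (r + 1), (i : ℤ) :=
      Finset.single_le_sum (f := fun i : ℕ => (i : ℤ)) (fun i _ => by positivity)
        (Finset.self_mem_range_succ r)
    have step : ∀ P : R, ∀ b : ℤ, |b| = r + 1 →
        ((∀ b : ℤ, r < |b| → |b| ≤ m → Commute P (y b)) ∧
        ∃ l : ℤ, ∀ t, l ≤ t → t ≤ l + ∑ i ∈ Finset.range (r + 1), (i : ℤ) → e t * P = 0) →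
        ((∀ d : ℤ, (r + 1 : ℕ) < |d| → |d| ≤ m → Commute (P * (y b * y (-b))) (y d)) ∧
        ∃ l : ℤ, ∀ t, l ≤ t → t ≤ l + ∑ i ∈ Finset.range (r + 1 + 1), (i : ℤ) →
          e t * (P * (y b * y (-b))) = 0) := by
      rintro P b hb ⟨hP, l, hl⟩
      refine ⟨fun d hd hdm => ?_, ?_⟩
      · refine (hP d (by push_cast at hd; omega) hdm).mul_left ?_
        have h1 := h_anti b d (by omega) hdm (by push_cast at hd; grind)
        have h2 := h_anti (-b) d (by rw [abs_neg]; omega) hdm (by push_cast at hd; grind)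
        show y b * y (-b) * y d = y d * (y b * y (-b))
        rw [mul_assoc, h2, mul_neg, ← mul_assoc, h1, neg_mul, neg_neg, mul_assoc]
      · have stay : ∀ t, e t * P = 0 → e t * (P * (y b * y (-b))) = 0 := fun t ht => by
          rw [← mul_assoc, ht, zero_mul]
        have move : ∀ t, e (t - b) * P = 0 → e t * (P * (y b * y (-b))) = 0 := fun t ht => by
          have hPb : P * y b = y b * P := hP b (by omega) (by omega)
          rw [← mul_assoc P, hPb, mul_assoc, ← mul_assoc, h_shift, mul_assoc, ← mul_assoc (e _),
            ht, zero_mul, mul_zero]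
        rw [Finset.sum_range_succ _ (r + 1)]
        push_cast
        generalize ∑ i ∈ Finset.range (r + 1), (i : ℤ) = L at *
        rcases (abs_eq (by positivity)).1 hb with rfl | rfl
        · refine ⟨l, fun t h1 h2 => ?_⟩
          by_cases h : t ≤ l + L
          · exact stay t (hl t h1 h)
          · exact move t (hl _ (by omega) (by omega))
        · refine ⟨l - (r + 1), fun t h1 h2 => ?_⟩
          by_cases h : l ≤ t
          · exact stay t (hl t h (by omega))
          · exact move t (hl _ (by omega) (by omega))
    rw [pow_succ]
    refine AddSubmonoid.closure_induction (motive := fun P _ => P * c ∈ _) ?_ ?_ ?_ (ih (by omega))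
    · intro P hP
      rw [← h_pair (r + 1), mul_add]
      refine add_mem (AddSubmonoid.subset_closure (step P (r + 1) ?_ hP))
        (AddSubmonoid.subset_closure ?_)
      · exact abs_of_nonneg (by positivity)
      · have := step P (-(r + 1)) (by rw [abs_neg]; exact abs_of_nonneg (by positivity)) hP
        rwa [neg_neg] at this
    · simp
    · intro P Q _ _ hP hQ
      rw [add_mul]
      exact add_mem hP hQ

/-- A nilpotent generator can be dropped from an ideal containing a power of a central element. -/
theorem exists_pow_mem_of_insert {R ι : Type*} [Ring R] {c : ι → R} {z : R}
    (hz : ∀ r, Commute z r) (hc : ∀ i j, Commute (c i) (c j)) {i : ι} (hi : IsNilpotent (c i))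
    {T : Set ι} (h : ∃ m, z ^ m ∈ Ideal.span (c '' insert i T)) :
    ∃ m, z ^ m ∈ Ideal.span (c '' T) := by
  obtain ⟨m, hm⟩ := h
  rw [Set.image_insert_eq, Ideal.mem_span_insert] at hm
  obtain ⟨r, u, hu, hm⟩ := hm
  obtain ⟨N, hN⟩ := hi
  have hmul : ∀ v ∈ Ideal.span (c '' T), ∀ t, v * c i ^ t ∈ Ideal.span (c '' T) := by
    intro v hv t
    refine Submodule.span_induction (p := fun v _ => v * c i ^ t ∈ Ideal.span (c '' T))
      ?_ ?_ ?_ ?_ hv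
    · rintro _ ⟨j, hj, rfl⟩
      rw [((hc j i).pow_right t).eq]
      exact Ideal.mul_mem_left _ _ (Ideal.subset_span ⟨j, hj, rfl⟩)
    · simp
    · intro a b _ _ ha hb
      rw [add_mul]
      exact add_mem ha hb
    · intro a b _ hb
      rw [smul_eq_mul, mul_assoc]
      exact Ideal.mul_mem_left _ _ hb
  have key : ∀ d ≤ N, ∃ M, z ^ M * c i ^ (N - d) ∈ Ideal.span (c '' T) := by
    intro d
    induction d with
    | zero => exact fun _ => ⟨0, by simp [hN]⟩
    | succ d ih =>
      intro hd
      obtain ⟨M, hM⟩ := ih (by omega)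
      refine ⟨M + m, ?_⟩
      have e : N - d = N - (d + 1) + 1 := by omega
      have : z ^ (M + m) * c i ^ (N - (d + 1)) =
          r * (z ^ M * c i ^ (N - d)) + z ^ M * (u * c i ^ (N - (d + 1))) := by
        rw [e, pow_succ' (c i), pow_add, hm, mul_add, add_mul, ← mul_assoc r,
          ← ((hz r).pow_left M).eq]
        simp only [mul_assoc]
      rw [this]
      exact add_mem (Ideal.mul_mem_left _ _ hM) (Ideal.mul_mem_left _ _ (hmul u hu _))
  simpa using key N le_rfl

theorem isNilpotent_of_pow_mem_span {R ι : Type*} [Ring R] {c : ι → R} {z : R}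
    (hz : ∀ r, Commute z r) (hc : ∀ i j, Commute (c i) (c j)) (T : Finset ι)
    (hT : ∀ i ∈ T, IsNilpotent (c i)) (h : ∃ m, z ^ m ∈ Ideal.span (c '' T)) :
    IsNilpotent z := by
  classical
  induction T using Finset.induction_on with
  | empty => simpa [IsNilpotent] using h
  | insert i T _ ih =>
    refine ih (fun j hj => hT j (Finset.mem_insert_of_mem hj)) ?_
    rw [Finset.coe_insert] at h
    exact exists_pow_mem_of_insert hz hc (hT i (Finset.mem_insert_self i T)) h

theorem mul_mem_prod_of_anticommute {k R ι : Type*} [Field k] [Ring R] [Algebra k R]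
    {x : ι → R} (hx : ∀ i j, i ≠ j → x i * x j = -(x j * x i)) {W : ι → Submodule k R}
    (hW : ∀ i, ∃ S : Set ℕ, W i = Submodule.span k ((x i ^ ·) '' S))
    (hmul : ∀ i, ∀ w ∈ W i, x i * w ∈ W i) (L : List ι) {j : ι} (hj : j ∈ L) :
    ∀ w ∈ (L.map W).prod, x j * w ∈ (L.map W).prod := by
  induction L with
  | nil => simp at hj
  | cons i L ih =>
    rw [List.map_cons, List.prod_cons]
    intro w hw
    by_cases hij : j = i
    · subst hij
      refine Submodule.mul_induction_on hw (fun a ha b hb => ?_) (fun a b ha hb => ?_)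
      · rw [← mul_assoc]
        exact Submodule.mul_mem_mul (hmul j a ha) hb
      · rw [mul_add]
        exact add_mem ha hb
    · have hj' : j ∈ L := (List.mem_cons.1 hj).resolve_left hij
      refine Submodule.mul_induction_on hw (fun a ha b hb => ?_) (fun a b ha hb => ?_)
      · obtain ⟨S, hS⟩ := hW i
        rw [hS] at ha
        refine Submodule.span_induction (p := fun a _ => x j * (a * b) ∈ W i * (L.map W).prod)
          ?_ ?_ ?_ ?_ ha
        · rintro _ ⟨t, ht, rfl⟩
          have hsign : ∀ t : ℕ, x j * x i ^ t = (-1) ^ t * (x i ^ t * x j) := by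
            intro t
            induction t with
            | zero => simp
            | succ t iht =>
              rw [pow_succ (x i), ← mul_assoc, iht, pow_succ (-1 : R), mul_assoc, mul_assoc,
                hx j i hij]
              simp [mul_assoc]
          have hmem : x i ^ t * (x j * b) ∈ W i * (L.map W).prod :=
            Submodule.mul_mem_mul (by rw [hS]; exact Submodule.subset_span ⟨t, ht, rfl⟩)
              (ih hj' b hb)
          simp only
          rw [← mul_assoc, hsign, mul_assoc, mul_assoc]
          rcases neg_one_pow_eq_or R t with h | h <;> rw [h]
          · simpa using hmem
          · simpa using hmem
        · simp
        · intro a a' _ _ ha ha'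
          rw [add_mul, mul_add]
          exact add_mem ha ha'
        · intro r a _ ha
          rw [smul_mul_assoc, mul_smul_comm]
          exact Submodule.smul_mem _ _ ha
      · rw [mul_add]
        exact add_mem ha hb

/-- An algebra generated by anticommuting nilpotent elements and an element of finite order
permuting them is finite-dimensional. -/
theorem finiteDimensional_of_isNilpotent {k R ι : Type*} [Field k] [Ring R] [Algebra k R]
    [Finite ι] {x : ι → R} {s : R} {n : ℕ} (hn : 0 < n)
    (hx : ∀ i j, i ≠ j → x i * x j = -(x j * x i)) (hs : s ^ n = 1)
    (hxs : ∀ i, ∃ j, x i * s = s * x j) (hnil : ∀ i, IsNilpotent (x i))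
    (hgen : Algebra.adjoin k (insert s (Set.range x)) = ⊤) : FiniteDimensional k R := by
  cases nonempty_fintype ι
  choose N hN using hnil
  set W : ι → Submodule k R := fun i => Submodule.span k ((x i ^ ·) '' Set.Iio (N i)) with hW
  set L : List ι := Finset.univ.toList with hL
  set P : Submodule k R := (L.map W).prod with hP
  set V : Submodule k R := Submodule.span k ((s ^ ·) '' Set.Iio n) * P with hV
  have hWmul : ∀ i, ∀ w ∈ W i, x i * w ∈ W i := by
    intro i w hw
    refine Submodule.span_induction (p := fun w _ => x i * w ∈ W i) ?_ ?_ ?_ ?_ hw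
    · rintro _ ⟨t, ht, rfl⟩
      simp only
      rw [← pow_succ']
      by_cases h : t + 1 < N i
      · exact Submodule.subset_span ⟨t + 1, h, rfl⟩
      · have : t + 1 = N i := by have := Set.mem_Iio.1 ht; omega
        rw [this, hN]
        exact zero_mem _
    · simp
    · intro a b _ _ ha hb
      rw [mul_add]
      exact add_mem ha hb
    · intro r a _ ha
      rw [mul_smul_comm]
      exact Submodule.smul_mem _ _ ha
  have hWone : ∀ i, (1 : R) ∈ W i := by
    intro i
    rcases Nat.eq_zero_or_pos (N i) with h | h
    · have h1 : (1 : R) = 0 := by simpa [h] using hN i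
      rw [h1]
      exact zero_mem _
    · exact Submodule.subset_span ⟨0, h, by simp⟩
  have hPmul : ∀ j, ∀ w ∈ P, x j * w ∈ P := fun j =>
    mul_mem_prod_of_anticommute hx (fun i => ⟨_, rfl⟩) hWmul L (by simp [hL])
  have hPfg_one : ∀ L : List ι, (L.map W).prod.FG ∧ (1 : R) ∈ (L.map W).prod := by
    intro L
    induction L with
    | nil =>
      refine ⟨?_, by simp [Submodule.one_le.1 le_rfl]⟩
      simpa [Submodule.one_eq_span] using Submodule.fg_span_singleton (R := k) (1 : R)
    | cons i L ih =>
      rw [List.map_cons, List.prod_cons]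
      refine ⟨(Submodule.fg_span ((Set.finite_Iio _).image _)).mul ih.1, ?_⟩
      simpa using Submodule.mul_mem_mul (hWone i) ih.2
  have hxspow : ∀ t i, ∃ j, x i * s ^ t = s ^ t * x j := by
    intro t
    induction t with
    | zero => exact fun i => ⟨i, by simp⟩
    | succ t ih =>
      intro i
      obtain ⟨j, hj⟩ := ih i
      obtain ⟨l, hl⟩ := hxs j
      exact ⟨l, by rw [pow_succ, ← mul_assoc, hj, mul_assoc, hl, mul_assoc]⟩
  have hVind : ∀ g : R, (∀ t < n, ∀ p ∈ P, g * (s ^ t * p) ∈ V) → ∀ v ∈ V, g * v ∈ V := by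
    intro g hg v hv
    refine Submodule.mul_induction_on hv (fun a ha b hb => ?_) (fun a b ha hb => ?_)
    · refine Submodule.span_induction (p := fun a _ => g * (a * b) ∈ V) ?_ ?_ ?_ ?_ ha
      · rintro _ ⟨t, ht, rfl⟩
        exact hg t ht b hb
      · simp
      · intro a a' _ _ ha ha'
        rw [add_mul, mul_add]
        exact add_mem ha ha'
      · intro r a _ ha
        rw [smul_mul_assoc, mul_smul_comm]
        exact Submodule.smul_mem _ _ ha
    · rw [mul_add]
      exact add_mem ha hb
  have hVmem : ∀ t < n, ∀ p ∈ P, s ^ t * p ∈ V := fun t ht p hp =>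
    Submodule.mul_mem_mul (Submodule.subset_span ⟨t, ht, rfl⟩) hp
  have hVgen : ∀ g ∈ insert s (Set.range x), ∀ v ∈ V, g * v ∈ V := by
    rintro g (rfl | ⟨i, rfl⟩)
    · refine hVind _ fun t ht p hp => ?_
      rw [← mul_assoc, ← pow_succ']
      by_cases h : t + 1 < n
      · exact hVmem _ h p hp
      · obtain h : t + 1 = n := by omega
        rw [h, hs, ← pow_zero g]
        exact hVmem 0 hn p hp
    · refine hVind _ fun t ht p hp => ?_
      obtain ⟨j, hj⟩ := hxspow t i
      rw [← mul_assoc, hj, mul_assoc]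
      exact hVmem t ht _ (hPmul j p hp)
  have hVall : ∀ g : R, ∀ v ∈ V, g * v ∈ V := by
    intro g
    have hg : g ∈ Algebra.adjoin k (insert s (Set.range x)) := hgen ▸ Algebra.mem_top
    induction hg using Algebra.adjoin_induction with
    | mem g hg => exact hVgen g hg
    | algebraMap r =>
      intro v hv
      rw [← Algebra.smul_def]
      exact Submodule.smul_mem _ _ hv
    | add a b _ _ ha hb =>
      intro v hv
      rw [add_mul]
      exact add_mem (ha v hv) (hb v hv)
    | mul a b _ _ ha hb =>
      intro v hv
      rw [mul_assoc]
      exact ha _ (hb v hv)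
  have hVone : (1 : R) ∈ V := by
    simpa using hVmem 0 hn 1 (hPfg_one L).2
  have hVtop : V = ⊤ := by
    refine eq_top_iff.2 fun g _ => ?_
    simpa using hVall g 1 hVone
  refine Module.finite_def.2 ?_
  rw [← hVtop]
  exact (Submodule.fg_span ((Set.finite_Iio _).image _)).mul (hPfg_one L).1

section Weights

variable {k R : Type*} [Field k] [Ring R] [Algebra k R] {n : ℕ}

/-- The discrete Fourier transform of a family indexed by `ZMod n`, with respect to an additive
character `χ`. -/
def charSum [NeZero n] (χ : AddChar (ZMod n) k) (f : ZMod n → R) (a : ZMod n) : R :=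
  ∑ i, χ (i * a) • f i

/-- The isotypic idempotent of weight `t` of the cyclic group generated by `s`. -/
def isotypic (χ : AddChar (ZMod n) k) (s : R) (t : ZMod n) : R :=
  (n : k)⁻¹ • ∑ i ∈ Finset.range n, χ (i * t) • s ^ i

/-- The element `z` is homogeneous of weight `a` for the conjugation action of `s`. -/
def HasWeight (χ : AddChar (ZMod n) k) (s : R) (a : ZMod n) (z : R) : Prop :=
  s * z = χ (-a) • (z * s)

variable {χ : AddChar (ZMod n) k} {s : R}

theorem HasWeight.mul {a b : ZMod n} {z w : R} (hz : HasWeight χ s a z)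
    (hw : HasWeight χ s b w) : HasWeight χ s (a + b) (z * w) := by
  unfold HasWeight at *
  rw [← mul_assoc, hz, smul_mul_assoc, mul_assoc, hw, mul_smul_comm, smul_smul, neg_add,
    χ.map_add_eq_mul, mul_assoc]

theorem HasWeight.pow {a : ZMod n} {z : R} (hz : HasWeight χ s a z) (t : ℕ) :
    HasWeight χ s (t * a) (z ^ t) := by
  induction t with
  | zero => simp [HasWeight]
  | succ t ih =>
    rw [pow_succ, Nat.cast_succ, add_mul, one_mul]
    exact ih.mul hz

theorem HasWeight.pow_mul_eq {a : ZMod n} {z : R} (hz : HasWeight χ s a z) (t : ℕ) :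
    s ^ t * z = χ (-(t * a)) • (z * s ^ t) := by
  induction t with
  | zero => simp
  | succ t ih =>
    rw [pow_succ', mul_assoc, ih, mul_smul_comm, ← mul_assoc, hz, smul_mul_assoc, smul_smul,
      mul_assoc, ← χ.map_add_eq_mul]
    congr 2
    push_cast
    ring

theorem HasWeight.isotypic_mul {a : ZMod n} {z : R} (hz : HasWeight χ s a z) (t : ZMod n) :
    isotypic χ s t * z = z * isotypic χ s (t - a) := by
  simp only [isotypic, smul_mul_assoc, mul_smul_comm, Finset.sum_mul, Finset.mul_sum,
    hz.pow_mul_eq, smul_smul, ← χ.map_add_eq_mul]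
  congr 1
  refine Finset.sum_congr rfl fun i _ => ?_
  congr 2
  ring

theorem isotypic_zero (h : ∑ i ∈ Finset.range n, s ^ i = 0) : isotypic χ s 0 = 0 := by
  simp [isotypic, h]

theorem isotypic_mul_mul_eq_zero (h : ∑ i ∈ Finset.range n, s ^ i = 0) {a : ZMod n} {z : R}
    (hz : HasWeight χ s a z) (w : R) : isotypic χ s a * (z * w) = 0 := by
  rw [← mul_assoc, hz.isotypic_mul, sub_self, isotypic_zero h, mul_zero, zero_mul]

variable [NeZero n]

theorem sum_isotypic (hχ : χ.IsPrimitive) (hnk : (n : k) ≠ 0) :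
    ∑ t, isotypic χ s t = 1 := by
  simp only [isotypic, ← Finset.smul_sum]
  rw [Finset.sum_comm]
  simp only [← Finset.sum_smul, mul_comm _ (_ : ZMod n), AddChar.sum_mulShift _ hχ]
  rw [Finset.sum_eq_single 0]
  · simp [hnk]
  · intro i hi hi0
    rw [if_neg, Nat.cast_zero, zero_smul]
    rw [ZMod.natCast_eq_zero_iff]
    exact Nat.not_dvd_of_pos_of_lt (by omega) (Finset.mem_range.1 hi)
  · simp [NeZero.pos n]

theorem eq_zero_of_isotypic_mul (hχ : χ.IsPrimitive) (hnk : (n : k) ≠ 0) {z : R}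
    (h : ∀ t, isotypic χ s t * z = 0) : z = 0 := by
  rw [← one_mul z, ← sum_isotypic (s := s) hχ hnk, Finset.sum_mul]
  exact Finset.sum_eq_zero fun t _ => h t

theorem HasWeight.pow_eq_zero [Fact n.Prime] (hχ : χ.IsPrimitive) (hnk : (n : k) ≠ 0)
    (h : ∑ i ∈ Finset.range n, s ^ i = 0) {a : ZMod n} (ha : a ≠ 0) {z : R}
    (hz : HasWeight χ s a z) : z ^ n = 0 := by
  refine eq_zero_of_isotypic_mul (s := s) hχ hnk fun t => ?_
  have ht : (((t * a⁻¹).val : ℕ) : ZMod n) * a = t := by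
    rw [ZMod.natCast_zmod_val, inv_mul_cancel_right₀ ha]
  have hw := hz.pow (t * a⁻¹).val
  rw [ht] at hw
  have hpow : z ^ n = z ^ (t * a⁻¹).val * z ^ (n - (t * a⁻¹).val) := by
    rw [← pow_add, Nat.add_sub_cancel' (ZMod.val_lt (t * a⁻¹)).le]
  rw [hpow]
  exact isotypic_mul_mul_eq_zero h hw _

theorem hasWeight_charSum {f : ZMod n → R} (hf : ∀ i, s * f i = f (i + 1) * s) (a : ZMod n) :
    HasWeight χ s a (charSum χ f a) := by
  unfold HasWeight charSum
  rw [Finset.mul_sum, Finset.sum_mul, Finset.smul_sum]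
  refine Fintype.sum_equiv (Equiv.addRight 1) _ _ fun i => ?_
  simp only [Equiv.coe_addRight, mul_smul_comm, smul_mul_assoc, hf, smul_smul,
    ← χ.map_add_eq_mul]
  congr 2
  ring

theorem sum_smul_charSum (hχ : χ.IsPrimitive) (f : ZMod n → R) (i : ZMod n) :
    ∑ a, χ (-(i * a)) • charSum χ f a = (n : k) • f i := by
  simp only [charSum, Finset.smul_sum, smul_smul, ← χ.map_add_eq_mul]
  rw [Finset.sum_comm]
  have e : ∀ j a : ZMod n, -(i * a) + j * a = a * (j - i) := fun j a => by ring
  simp only [e, ← Finset.sum_smul, AddChar.sum_mulShift _ hχ]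
  rw [Finset.sum_eq_single i]
  · simp [ZMod.card]
  · intro j _ hj
    simp [sub_ne_zero.2 hj]
  · simp

theorem charSum_anticommutator {x : ZMod n → R} (hx : ∀ i j, i ≠ j → x i * x j = -(x j * x i))
    (a b : ZMod n) :
    charSum χ x a * charSum χ x b + charSum χ x b * charSum χ x a =
      charSum χ (fun i => x i * x i + x i * x i) (a + b) := by
  have h : ∀ a b, charSum χ x a * charSum χ x b = ∑ i, ∑ j, χ (i * a + j * b) • (x i * x j) :=
    fun a b => by simp only [charSum, Finset.sum_mul_sum, smul_mul_smul_comm, χ.map_add_eq_mul]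
  rw [h, h, Finset.sum_comm (γ := ZMod n) (f := fun i j => χ (i * b + j * a) • (x i * x j)),
    ← Finset.sum_add_distrib]
  refine Finset.sum_congr rfl fun i _ => ?_
  rw [← Finset.sum_add_distrib, Finset.sum_eq_single i]
  · rw [add_comm (i * b), ← smul_add, mul_add]
  · intro j _ hj
    simp [add_comm, hx i j (Ne.symm hj)]
  · simp

theorem commute_charSum {f : ZMod n → R} {r : R} (h : ∀ i, Commute (f i) r) (a : ZMod n) :
    Commute (charSum χ f a) r :=
  Commute.sum_left _ _ _ fun i _ => (h i).smul_left _

end Weights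

section Nilpotency

variable {k R : Type*} [Field k] [Ring R] [Algebra k R] {n : ℕ}
  {χ : AddChar (ZMod n) k} {x : ZMod n → R} {s : R}

theorem commute_sq_of_anticommute (hx : ∀ i j, i ≠ j → x i * x j = -(x j * x i))
    (i j : ZMod n) : Commute (x i * x i + x i * x i) (x j) := by
  have h : Commute (x i * x i) (x j) := by
    rcases eq_or_ne i j with rfl | hij
    · exact (Commute.refl _).mul_left (Commute.refl _)
    · show x i * x i * x j = x j * (x i * x i)
      rw [mul_assoc, hx i j hij, mul_neg, ← mul_assoc, hx i j hij, neg_mul, neg_neg, mul_assoc]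
  exact h.add_left h

theorem semiconj_sq (hs : ∀ i, s * x i = x (i + 1) * s) (i : ZMod n) :
    s * (x i * x i + x i * x i) = (x (i + 1) * x (i + 1) + x (i + 1) * x (i + 1)) * s := by
  have h : s * (x i * x i) = x (i + 1) * x (i + 1) * s := by
    rw [← mul_assoc, hs, mul_assoc, hs, mul_assoc]
  rw [mul_add, add_mul, h]

theorem intCast_zmod_ne_zero_of_abs_lt {a : ℤ} (ha : a ≠ 0) (h : |a| < n) : (a : ZMod n) ≠ 0 := by
  rw [Ne, ZMod.intCast_zmod_eq_zero_iff_dvd]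
  exact fun hd => ha (Int.eq_zero_of_abs_lt_dvd hd h)

variable [NeZero n]

theorem isTwoSided_span_charSum_sq (hx : ∀ i j, i ≠ j → x i * x j = -(x j * x i))
    (hs : ∀ i, s * x i = x (i + 1) * s)
    (hgen : Algebra.adjoin k (insert s (Set.range x)) = ⊤) (T : Set (ZMod n)) :
    (Ideal.span (charSum χ (fun i => x i * x i + x i * x i) '' T)).IsTwoSided := by
  set c := charSum χ (fun i => x i * x i + x i * x i) with hc
  set I := Ideal.span (c '' T) with hI
  have hgenerators : ∀ g ∈ insert s (Set.range x), ∀ a ∈ T, c a * g ∈ I := by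
    rintro g hg a ha
    have hca : c a ∈ I := Ideal.subset_span ⟨a, ha, rfl⟩
    rcases hg with rfl | ⟨i, rfl⟩
    · have hw : g * c a = χ (-a) • (c a * g) := hasWeight_charSum (semiconj_sq hs) a
      have : c a * g = χ a • (g * c a) := by
        rw [hw, smul_smul, ← χ.map_add_eq_mul, add_neg_cancel, χ.map_zero_eq_one, one_smul]
      rw [this, ← smul_mul_assoc]
      exact Ideal.mul_mem_left _ _ hca
    · rw [(commute_charSum (fun j => commute_sq_of_anticommute hx j i) a).eq]
      exact Ideal.mul_mem_left _ _ hca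
  have hstable : ∀ g : R, (∀ a ∈ T, c a * g ∈ I) → ∀ v ∈ I, v * g ∈ I := by
    intro g hg v hv
    refine Submodule.span_induction (p := fun v _ => v * g ∈ I) ?_ ?_ ?_ ?_ hv
    · rintro _ ⟨a, ha, rfl⟩
      exact hg a ha
    · simp
    · intro a b _ _ ha hb
      rw [add_mul]
      exact add_mem ha hb
    · intro a b _ hb
      rw [smul_eq_mul, mul_assoc]
      exact Ideal.mul_mem_left _ _ hb
  refine ⟨fun {v} g hv => ?_⟩
  have hg : g ∈ Algebra.adjoin k (insert s (Set.range x)) := hgen ▸ Algebra.mem_top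
  induction hg using Algebra.adjoin_induction generalizing v with
  | mem g hg => exact hstable g (hgenerators g hg) v hv
  | algebraMap r =>
    rw [← Algebra.commutes]
    exact Ideal.mul_mem_left _ _ hv
  | add a b _ _ ha hb =>
    rw [mul_add]
    exact add_mem (ha hv) (hb hv)
  | mul a b _ _ ha hb =>
    rw [← mul_assoc]
    exact hb (ha hv)

theorem charSum_sq_zero_central (hx : ∀ i j, i ≠ j → x i * x j = -(x j * x i))
    (hs : ∀ i, s * x i = x (i + 1) * s)
    (hgen : Algebra.adjoin k (insert s (Set.range x)) = ⊤) (r : R) :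
    Commute (charSum χ (fun i => x i * x i + x i * x i) 0) r := by
  have hr : r ∈ Algebra.adjoin k (insert s (Set.range x)) := hgen ▸ Algebra.mem_top
  induction hr using Algebra.adjoin_induction with
  | mem g hg =>
    rcases hg with rfl | ⟨i, rfl⟩
    · have hw := hasWeight_charSum (χ := χ) (semiconj_sq hs) 0
      rw [HasWeight, neg_zero, χ.map_zero_eq_one, one_smul] at hw
      exact hw.symm
    · exact commute_charSum (fun j => commute_sq_of_anticommute hx j i) 0
  | algebraMap r => exact (Algebra.commutes r _).symm
  | add a b _ _ ha hb => exact ha.add_right hb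
  | mul a b _ _ ha hb => exact ha.mul_right hb

theorem exists_intCast_zmod_eq_of_le (l : ℤ) (t : ZMod n) :
    ∃ u : ℤ, l ≤ u ∧ u < l + n ∧ (u : ZMod n) = t := by
  have hn : (0 : ℤ) < n := by exact_mod_cast NeZero.pos n
  have := ZMod.val_lt (t - (l : ZMod n))
  refine ⟨l + (t - (l : ZMod n)).val, by omega, by omega, ?_⟩
  push_cast
  rw [ZMod.natCast_zmod_val]
  ring

theorem two_mul_le_sum_range {m : ℕ} (hm : 3 ≤ m) :
    (2 * m : ℤ) ≤ ∑ i ∈ Finset.range (m + 1), (i : ℤ) := by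
  induction m, hm using Nat.le_induction with
  | base => decide
  | succ m hm ih =>
    rw [Finset.sum_range_succ]
    push_cast
    omega

/-- Modulo the Fourier coefficients of nonzero weight of the squares, the `y_a` satisfy Clifford
relations, and the subset sums of `{1, …, m}` cover `ZMod n`; hence a power of the weight zero
coefficient vanishes. -/
theorem charSum_sq_zero_pow_mem (hχ : χ.IsPrimitive) (hnk : (n : k) ≠ 0) {m : ℕ} (hm : 3 ≤ m)
    (hnm : n = 2 * m + 1) (hx : ∀ i j, i ≠ j → x i * x j = -(x j * x i))
    (hs : ∀ i, s * x i = x (i + 1) * s) (hsum : ∑ i ∈ Finset.range n, s ^ i = 0)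
    (hgen : Algebra.adjoin k (insert s (Set.range x)) = ⊤) :
    charSum χ (fun i => x i * x i + x i * x i) 0 ^ m ∈
      Ideal.span (charSum χ (fun i => x i * x i + x i * x i) '' {a | a ≠ 0}) := by
  set c := charSum χ (fun i => x i * x i + x i * x i) with hc
  set I := Ideal.span (c '' {a | a ≠ 0}) with hI
  have : I.IsTwoSided := isTwoSided_span_charSum_sq hx hs hgen _
  let π := Ideal.Quotient.mk I
  have hπ : ∀ a ≠ 0, π (c a) = 0 := fun a ha =>
    Ideal.Quotient.eq_zero_iff_mem.2 (Ideal.subset_span ⟨a, ha, rfl⟩)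
  have hanti : ∀ a b : ZMod n, π (charSum χ x a) * π (charSum χ x b) +
      π (charSum χ x b) * π (charSum χ x a) = π (c (a + b)) := fun a b => by
    rw [← map_mul, ← map_mul, ← map_add, charSum_anticommutator hx]
  have hmem := pow_mem_closure_annihilated (fun a : ℤ => π (charSum χ x (a : ZMod n)))
    (fun t : ℤ => π (isotypic χ s (t : ZMod n))) (π (c 0)) m
    (fun a b ha hb hab => by
      rw [eq_neg_iff_add_eq_zero, hanti]
      refine hπ _ ?_
      rw [← Int.cast_add]
      refine intCast_zmod_ne_zero_of_abs_lt hab ?_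
      have := abs_add_le a b
      omega)
    (fun a => by
      rw [hanti]
      simp)
    (fun t a => by
      rw [← map_mul, ← map_mul, (hasWeight_charSum hs _).isotypic_mul, Int.cast_sub])
    (by simp [isotypic_zero hsum]) m le_rfl
  rw [← Ideal.Quotient.eq_zero_iff_mem, map_pow]
  refine (AddSubmonoid.closure_le (S := ⊥)).2 ?_ hmem
  rintro P ⟨-, l, hl⟩
  have hone : (1 : R ⧸ I) = ∑ t, π (isotypic χ s t) := by
    rw [← map_sum, sum_isotypic hχ hnk, map_one]
  show P = 0
  rw [← one_mul P, hone, Finset.sum_mul]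
  refine Finset.sum_eq_zero fun t _ => ?_
  obtain ⟨u, h1, h2, rfl⟩ := exists_intCast_zmod_eq_of_le l t
  have := two_mul_le_sum_range hm
  exact hl u h1 (by omega)

theorem charSum_sq_zero_eq_zero_of_two {χ : AddChar (ZMod 2) k} {x : ZMod 2 → R}
    (hχ : χ.IsPrimitive) (hnk : ((2 : ℕ) : k) ≠ 0)
    (hx : ∀ i j, i ≠ j → x i * x j = -(x j * x i))
    (hs : ∀ i, s * x i = x (i + 1) * s) (hsum : ∑ i ∈ Finset.range 2, s ^ i = 0) :
    charSum χ (fun i => x i * x i + x i * x i) 0 = 0 := by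
  have h := charSum_anticommutator (χ := χ) hx 1 1
  have hw := hasWeight_charSum (χ := χ) hs 1
  rw [show (1 + 1 : ZMod 2) = 0 from rfl] at h
  rw [← h]
  refine eq_zero_of_isotypic_mul (s := s) hχ hnk fun t => ?_
  have ht : t = 0 ∨ t = 1 := by
    revert t
    decide
  rcases ht with rfl | rfl
  · rw [isotypic_zero hsum, zero_mul]
  · rw [mul_add, isotypic_mul_mul_eq_zero hsum hw, add_zero]

theorem finiteDimensional_of_skewGroup_relations [IsAlgClosed k] [CharZero k] (hn : n.Prime)
    (h3 : n ≠ 3) (h5 : n ≠ 5) (hx : ∀ i j, i ≠ j → x i * x j = -(x j * x i))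
    (hs : ∀ i, s * x i = x (i + 1) * s) (hspow : s ^ n = 1)
    (hsum : ∑ i ∈ Finset.range n, s ^ i = 0)
    (hgen : Algebra.adjoin k (insert s (Set.range x)) = ⊤) : FiniteDimensional k R := by
  have : Fact n.Prime := ⟨hn⟩
  have hnk : (n : k) ≠ 0 := Nat.cast_ne_zero.2 hn.ne_zero
  have : NeZero (n : k) := ⟨hnk⟩
  obtain ⟨ζ, hζ⟩ := HasEnoughRootsOfUnity.exists_primitiveRoot k n
  let χ := AddChar.zmodChar n ((IsPrimitiveRoot.iff_def ζ n).mp hζ).left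
  have hχ : χ.IsPrimitive := AddChar.zmodChar_primitive_of_primitive_root n hζ
  set c := charSum χ (fun i => x i * x i + x i * x i) with hc
  have hcomm : ∀ a b, Commute (c a) (c b) := fun a b =>
    commute_charSum (fun i => (commute_charSum (fun j =>
      (commute_sq_of_anticommute hx j i).mul_right (commute_sq_of_anticommute hx j i) |>.add_right
        ((commute_sq_of_anticommute hx j i).mul_right (commute_sq_of_anticommute hx j i))) b).symm) a
  have hnil : ∀ a ≠ 0, IsNilpotent (c a) := fun a ha =>
    ⟨n, (hasWeight_charSum (semiconj_sq hs) a).pow_eq_zero hχ hnk hsum ha⟩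
  have hnil_zero : IsNilpotent (c 0) := by
    rcases hn.eq_two_or_odd' with rfl | ⟨m, hm⟩
    · rw [hc, charSum_sq_zero_eq_zero_of_two hχ hnk hx hs hsum]
      exact IsNilpotent.zero
    · have hm3 : 3 ≤ m := by
        have := hn.two_le
        omega
      refine isNilpotent_of_pow_mem_span (charSum_sq_zero_central hx hs hgen) hcomm
        (Finset.univ.filter (· ≠ 0)) (fun a ha => hnil a (Finset.mem_filter.1 ha).2) ⟨m, ?_⟩
      simpa using charSum_sq_zero_pow_mem hχ hnk hm3 hm hx hs hsum hgen
  have hnil_all : ∀ a, IsNilpotent (c a) := fun a =>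
    if ha : a = 0 then ha ▸ hnil_zero else hnil a ha
  have hnil_x : ∀ i, IsNilpotent (x i) := by
    intro i
    have h : IsNilpotent ((n : k) • (x i * x i + x i * x i)) := by
      rw [← sum_smul_charSum hχ (fun i => x i * x i + x i * x i) i]
      refine Commute.isNilpotent_sum (fun a _ => (hnil_all a).smul _) fun a b _ _ => ?_
      exact ((hcomm a b).smul_left _).smul_right _
    have h2 : IsNilpotent (x i ^ 2) := by
      have e : x i ^ 2 = ((n : k) * 2)⁻¹ • ((n : k) • (x i * x i + x i * x i)) := by
        rw [← two_smul k (x i * x i), smul_smul, smul_smul, mul_assoc, inv_mul_cancel₀, one_smul, sq]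
        exact mul_ne_zero hnk two_ne_zero
      rw [e]
      exact h.smul _
    exact h2.of_pow
  refine finiteDimensional_of_isNilpotent hn.pos hx hspow (fun i => ⟨i - 1, ?_⟩) hnil_x hgen
  rw [hs, sub_add_cancel]

end Nilpotency

open NCIS in
/-- Proposition 6.6(2): if `n` is a prime different from `3` and `5`, then
`E = (A#C_n)/(e₀)` is finite-dimensional over `k` (`n` is admissible). -/
theorem skewGroup_quotient_finiteDimensional_of_prime_ne_three_five
    (k : Type*) [Field k] [IsAlgClosed k] [CharZero k]
    (n : ℕ) (hn : n.Prime) (h3 : n ≠ 3) (h5 : n ≠ 5) :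
    FiniteDimensional k (Equot k n) := by
  have : NeZero n := ⟨hn.ne_zero⟩
  let p : SkewGroup k n →ₐ[k] Equot k n := RingQuot.mkAlgHom k _
  let q : FreeAlgebra k (ZMod n ⊕ Unit) →ₐ[k] SkewGroup k n := RingQuot.mkAlgHom k (SGRel k n)
  refine finiteDimensional_of_skewGroup_relations (x := fun i => p (xg k n i)) (s := p (sg k n))
    hn h3 h5 (fun i j hij => ?_) (fun i => ?_) ?_ ?_ ?_
  · have h : xg k n i * xg k n j + xg k n j * xg k n i = 0 := by
      simpa [xg] using RingQuot.mkAlgHom_rel k (SGRel.anti (k := k) i j hij)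
    rw [eq_neg_iff_add_eq_zero, ← map_mul, ← map_mul, ← map_add, h, map_zero]
  · have h : sg k n * xg k n i = xg k n (i + 1) * sg k n := by
      simpa [xg, sg] using RingQuot.mkAlgHom_rel k (SGRel.scomm (k := k) i)
    rw [← map_mul, h, map_mul]
  · have h : sg k n ^ n = 1 := by
      simpa [sg] using RingQuot.mkAlgHom_rel k (SGRel.spow (k := k) (n := n))
    rw [← map_pow, h, map_one]
  · have h : p (e0 k n) = 0 := by
      rw [← map_zero p]
      exact RingQuot.mkAlgHom_rel k ⟨rfl, rfl⟩
    have hsum : ∑ i ∈ Finset.range n, sg k n ^ i = (n : k) • e0 k n := by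
      rw [e0, smul_inv_smul₀ (Nat.cast_ne_zero.2 hn.ne_zero)]
    simp only [← map_pow]
    rw [← map_sum, hsum, map_smul, h, smul_zero]
  · have hsurj : Function.Surjective (p.comp q) :=
      (RingQuot.mkAlgHom_surjective k _).comp (RingQuot.mkAlgHom_surjective k _)
    rw [← (AlgHom.range_eq_top _).2 hsurj, ← Algebra.map_top, ← FreeAlgebra.adjoin_range_ι,
      AlgHom.map_adjoin, ← Set.range_comp]
    congr 1
    ext r
    simp [p, q, xg, sg, or_comm, eq_comm, Unique.exists_iff]
end

section
/- A carries an ℕ-grading with each x_i of degree 1 (induced from the free algebra, since the defining relations are homogeneous). For each r ≥ 0, the set of elements b_0^{i_0} ⋯ b_{n−1}^{i_{n−1}} c_0^{j_0} ⋯ c_{n−1}^{j_{n−1}} with i ∈ {0,1}^n, j ∈ ℕ^n and (i_0+⋯+i_{n−1}) + 2(j_0+⋯+j_{n−1}) = r is a k-vector-space basis of the degree-r homogeneous component A_r. In particular the set of all such monomials (over all r) is a k-basis of A. -/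
open scoped BigOperators

namespace NCIS

variable (k : Type*) [Field k] (n : ℕ)

/-- Relations defining the `(-1)`-skew polynomial ring `A = k_{-1}[x_0, …, x_{n-1}]`:
`x_i x_j + x_j x_i = 0` for all `i ≠ j` in `ℤ/n`. -/
inductive ARel : FreeAlgebra k (ZMod n) → FreeAlgebra k (ZMod n) → Prop
  | anti (i j : ZMod n) (h : i ≠ j) :
      ARel (FreeAlgebra.ι k i * FreeAlgebra.ι k j + FreeAlgebra.ι k j * FreeAlgebra.ι k i) 0

/-- The `(-1)`-skew polynomial ring `A = k_{-1}[x_0, …, x_{n-1}]`. -/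
abbrev SkewPoly := RingQuot (ARel k n)

/-- The image of the generator `x_i` in `A`. -/
noncomputable def xA (i : ZMod n) : SkewPoly k n :=
  RingQuot.mkAlgHom k (ARel k n) (FreeAlgebra.ι k i)

/-- The eigenvector `b_γ = (1/n) ∑_{i=0}^{n-1} ω^{iγ} x_i ∈ A`. -/
noncomputable def bA (ω : k) (γ : ZMod n) : SkewPoly k n :=
  (n : k)⁻¹ • ∑ i ∈ Finset.range n, ω ^ (i * γ.val) • xA k n (i : ZMod n)

/-- The central element `c_j = (2/n²) ∑_{i=0}^{n-1} ω^{ij} x_i² ∈ A`. -/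
noncomputable def cA (ω : k) (j : ZMod n) : SkewPoly k n :=
  (2 / (n : k) ^ 2) • ∑ i ∈ Finset.range n, ω ^ (i * j.val) • xA k n (i : ZMod n) ^ 2

/-- The algebra automorphism `σ` of `A` determined by `σ(x_i) = x_{i+1}`, generating the
action of the cyclic group `C_n` on `A`. -/
noncomputable def sigmaA : SkewPoly k n →ₐ[k] SkewPoly k n :=
  RingQuot.liftAlgHom k
    ⟨(RingQuot.mkAlgHom k (ARel k n)).comp
        (FreeAlgebra.lift k (fun i : ZMod n => FreeAlgebra.ι k (i + 1))), by
      intro x y h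
      induction h with
      | anti i j hij =>
        have hne : i + 1 ≠ j + 1 := fun hc => hij (by exact add_left_injective 1 hc)
        have := RingQuot.mkAlgHom_rel k (ARel.anti (k := k) (n := n) (i + 1) (j + 1) hne)
        simpa using this⟩

/-- The `ω^{-j}`-eigenspace `R_j = {a ∈ A : σ·a = ω^{−j} a}` of the `C_n`-action on `A`. -/
def Rcomp (ω : k) (j : ZMod n) : Set (SkewPoly k n) :=
  {a : SkewPoly k n | sigmaA k n a = (ω ^ j.val)⁻¹ • a}

/-- The right ideal `R_j A` of `A` generated by `R_j`. -/
noncomputable def RcompA (ω : k) (j : ZMod n) : Submodule k (SkewPoly k n) :=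
  Submodule.span k {y : SkewPoly k n | ∃ r ∈ Rcomp k n ω j, ∃ a : SkewPoly k n, y = r * a}

end NCIS

namespace NCIS

variable (k : Type*) [Field k] (n : ℕ)

/-- The degree-`r` homogeneous component `A_r` of `A` for the grading with each `x_i` of
degree `1` (induced from the free algebra): the span of all products of `r` generators. -/
noncomputable def Adeg (r : ℕ) : Submodule k (SkewPoly k n) :=
  Submodule.span k
    {y : SkewPoly k n | ∃ w : Fin r → ZMod n, y = (List.ofFn fun t => xA k n (w t)).prod}

/-- The monomial `b_0^{i_0} ⋯ b_{n−1}^{i_{n−1}} c_0^{j_0} ⋯ c_{n−1}^{j_{n−1}}` of `A`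
attached to the pair of exponent vectors `p = (i, j)`. -/
noncomputable def bcMonomial (ω : k) (p : (Fin n → ℕ) × (Fin n → ℕ)) : SkewPoly k n :=
  (List.ofFn fun t : Fin n => bA k n ω ((t : ℕ) : ZMod n) ^ p.1 t).prod *
    (List.ofFn fun t : Fin n => cA k n ω ((t : ℕ) : ZMod n) ^ p.2 t).prod

end NCIS

namespace NCIS

section Words

variable {k : Type*} [Field k] {n : ℕ}

theorem xA_mul_xA_add_of_ne {i j : ZMod n} (h : i ≠ j) :
    xA k n i * xA k n j + xA k n j * xA k n i = 0 := by
  have := RingQuot.mkAlgHom_rel k (ARel.anti (k := k) (n := n) i j h)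
  rwa [map_add, map_mul, map_mul, map_zero] at this

theorem xA_mul_xA_of_ne {i j : ZMod n} (h : i ≠ j) :
    xA k n i * xA k n j = (-1 : k) • (xA k n j * xA k n i) :=
  (eq_neg_of_add_eq_zero_left (xA_mul_xA_add_of_ne h)).trans (neg_one_smul k _).symm

theorem Adeg_eq_span_range_pow (r : ℕ) :
    Adeg k n r = Submodule.span k (Set.range (xA k n)) ^ r := by
  rw [Submodule.span_pow, Adeg]
  congr 1
  ext y
  rw [Set.mem_pow, Set.mem_ofPred_eq]
  constructor
  · rintro ⟨w, rfl⟩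
    exact ⟨fun t => ⟨xA k n (w t), w t, rfl⟩, rfl⟩
  · rintro ⟨f, rfl⟩
    choose w hw using fun t => (f t).2
    exact ⟨w, by simp [hw]⟩

/-- Products of generators along permuted words agree up to a unit scalar (in fact a sign). -/
theorem exists_units_smul_prod_map_xA_of_perm {w w' : List (ZMod n)} (h : w.Perm w') :
    ∃ ε : kˣ, (w.map (xA k n)).prod = ε • (w'.map (xA k n)).prod := by
  induction h with
  | nil => exact ⟨1, by simp⟩
  | cons i _ ih =>
    obtain ⟨ε, hε⟩ := ih
    exact ⟨ε, by
      rw [List.map_cons, List.prod_cons, hε, List.map_cons, List.prod_cons, Units.smul_def,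
        Units.smul_def, mul_smul_comm]⟩
  | swap i j l =>
    by_cases hij : j = i
    · exact ⟨1, by simp [hij]⟩
    · refine ⟨-1, ?_⟩
      simp only [List.map_cons, List.prod_cons, ← mul_assoc]
      rw [xA_mul_xA_of_ne hij, Units.smul_def, Units.val_neg, Units.val_one, smul_mul_assoc]
  | trans _ _ ih₁ ih₂ =>
    obtain ⟨ε₁, h₁⟩ := ih₁
    obtain ⟨ε₂, h₂⟩ := ih₂
    exact ⟨ε₁ * ε₂, by rw [h₁, h₂, mul_smul]⟩

variable (k n) in
/-- The monomial in the generators `x_i` with a given multiset of indices, the factors being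
ordered by a choice of enumeration of the multiset. -/
noncomputable def xMonomial (s : Multiset (ZMod n)) : SkewPoly k n :=
  (s.toList.map (xA k n)).prod

theorem exists_units_smul_xMonomial (w : List (ZMod n)) :
    ∃ ε : kˣ, (w.map (xA k n)).prod = ε • xMonomial k n (w : Multiset (ZMod n)) :=
  exists_units_smul_prod_map_xA_of_perm
    (Multiset.coe_eq_coe.mp (Multiset.coe_toList _).symm)

theorem Adeg_eq_span_xMonomial (r : ℕ) :
    Adeg k n r = Submodule.span k (xMonomial k n '' {s | s.card = r}) := by
  apply le_antisymm
  · refine Submodule.span_le.mpr ?_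
    rintro _ ⟨w, rfl⟩
    obtain ⟨ε, hε⟩ := exists_units_smul_xMonomial (k := k) (List.ofFn w)
    rw [List.map_ofFn] at hε
    change (List.ofFn (xA k n ∘ w)).prod ∈ _
    rw [hε]
    exact Submodule.smul_mem _ (ε : k) (Submodule.subset_span ⟨_, by simp, rfl⟩)
  · refine Submodule.span_le.mpr ?_
    rintro _ ⟨s, rfl, rfl⟩
    refine Submodule.subset_span ?_
    have hs : s.toList.length = s.card := Multiset.length_toList s
    refine ⟨fun t => s.toList.get (t.cast hs.symm), ?_⟩
    rw [xMonomial]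
    congr 1
    apply List.ext_get <;> simp

theorem iSup_Adeg : ⨆ r, Adeg k n r = ⊤ := by
  have htop : Algebra.adjoin k (Set.range (xA k n)) = ⊤ := by
    have hr : Set.range (xA k n) =
        RingQuot.mkAlgHom k (ARel k n) '' Set.range (FreeAlgebra.ι k) := by
      rw [← Set.range_comp]
      rfl
    rw [hr, ← AlgHom.map_adjoin, FreeAlgebra.adjoin_range_ι, Algebra.map_top,
      AlgHom.range_eq_top]
    exact RingQuot.mkAlgHom_surjective k _
  rw [eq_top_iff, ← Algebra.top_toSubmodule, ← htop, Algebra.adjoin_eq_span, Submodule.span_le]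
  intro y hy
  obtain ⟨l, hl, rfl⟩ := Submonoid.exists_list_of_mem_closure hy
  refine Submodule.mem_iSup_of_mem l.length ?_
  rw [Adeg_eq_span_range_pow, Submodule.span_pow]
  refine Submodule.subset_span (Set.mem_pow.mpr ⟨fun t => ⟨l.get t, hl _ (l.get_mem t)⟩, ?_⟩)
  simp

variable (k) in
/-- The operator on `k`-linear combinations of multisets representing left multiplication
by `x_i`: it adds `i` to a multiset, with the sign `-1` for each smaller element passed. -/
noncomputable def mulLeftOp (i : ZMod n) : Module.End k (Multiset (ZMod n) →₀ k) :=
  Finsupp.linearCombination k fun s =>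
    Finsupp.single (i ::ₘ s) ((-1) ^ (s.countP fun j => j.val < i.val))

theorem mulLeftOp_single (i : ZMod n) (s : Multiset (ZMod n)) (a : k) :
    mulLeftOp k i (Finsupp.single s a) =
      Finsupp.single (i ::ₘ s) (a * (-1) ^ (s.countP fun j => j.val < i.val)) := by
  simp [mulLeftOp]

theorem mulLeftOp_anticomm [NeZero n] {i j : ZMod n} (h : i ≠ j) :
    mulLeftOp k i * mulLeftOp k j + mulLeftOp k j * mulLeftOp k i = 0 := by
  refine Finsupp.lhom_ext fun s a => ?_
  have hv : i.val ≠ j.val := fun hc => h (ZMod.val_injective n hc)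
  rw [LinearMap.add_apply, Module.End.mul_apply, Module.End.mul_apply, mulLeftOp_single,
    mulLeftOp_single, mulLeftOp_single, mulLeftOp_single, Multiset.cons_swap j i s,
    ← Finsupp.single_add, Multiset.countP_cons, Multiset.countP_cons, LinearMap.zero_apply,
    Finsupp.single_eq_zero]
  rcases lt_or_gt_of_ne hv with hlt | hlt
  · simp only [hlt, hlt.not_gt, if_true, if_false]
    ring
  · simp only [hlt, hlt.not_gt, if_true, if_false]
    ring

variable (k n) in
/-- The representation of `A` on `k`-linear combinations of multisets of indices. -/
noncomputable def multisetRep [NeZero n] :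
    SkewPoly k n →ₐ[k] Module.End k (Multiset (ZMod n) →₀ k) :=
  RingQuot.liftAlgHom k ⟨FreeAlgebra.lift k (mulLeftOp k), by
    intro x y h
    induction h with
    | anti i j hij => simpa using mulLeftOp_anticomm hij⟩

theorem multisetRep_xA [NeZero n] (i : ZMod n) :
    multisetRep k n (xA k n i) = mulLeftOp k i := by
  rw [multisetRep, xA, RingQuot.liftAlgHom_mkAlgHom_apply, FreeAlgebra.lift_ι_apply]

theorem exists_units_multisetRep_word [NeZero n] (w : List (ZMod n)) :
    ∃ ε : kˣ, multisetRep k n (w.map (xA k n)).prod (Finsupp.single 0 1) =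
      ε • Finsupp.single (w : Multiset (ZMod n)) (1 : k) := by
  induction w with
  | nil => exact ⟨1, by simp⟩
  | cons i w ih =>
    obtain ⟨ε, hε⟩ := ih
    refine ⟨ε * (-1) ^ ((w : Multiset (ZMod n)).countP fun j => j.val < i.val), ?_⟩
    rw [List.map_cons, List.prod_cons, map_mul, multisetRep_xA, Module.End.mul_apply, hε,
      Units.smul_def, map_smul, mulLeftOp_single]
    simp [Units.smul_def]

theorem linearIndependent_xMonomial [NeZero n] : LinearIndependent k (xMonomial k n) := by
  choose ε hε using fun s : Multiset (ZMod n) => exists_units_multisetRep_word (k := k) s.toList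
  refine LinearIndependent.of_comp
    ((LinearMap.applyₗ (Finsupp.single 0 1)).comp (multisetRep k n).toLinearMap) ?_
  have hb : LinearIndependent k fun s : Multiset (ZMod n) => Finsupp.single s (1 : k) :=
    Finsupp.linearIndependent_single_one k _
  convert hb.units_smul ε using 1
  funext s
  simpa [xMonomial] using hε s

theorem isInternal_Adeg [NeZero n] : DirectSum.IsInternal (Adeg k n) := by
  rw [DirectSum.isInternal_submodule_iff_iSupIndep_and_iSup_eq_top]
  refine ⟨fun r => ?_, iSup_Adeg⟩
  have hle : ⨆ s, ⨆ (_ : s ≠ r), Adeg k n s ≤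
      Submodule.span k (xMonomial k n '' {s | s.card ≠ r}) := by
    refine iSup₂_le fun s hs => ?_
    rw [Adeg_eq_span_xMonomial]
    exact Submodule.span_mono (Set.image_mono fun t ht => by simp_all)
  refine Disjoint.mono_right hle ?_
  rw [Adeg_eq_span_xMonomial]
  exact linearIndependent_xMonomial.disjoint_span_image
    (Set.disjoint_left.mpr fun s hs hs' => hs' hs)

theorem finrank_Adeg [NeZero n] (r : ℕ) :
    Module.finrank k (Adeg k n r) = Fintype.card (Sym (ZMod n) r) := by
  rw [Adeg_eq_span_xMonomial, Set.image_eq_range]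
  exact finrank_span_eq_card (ι := Sym (ZMod n) r)
    (linearIndependent_xMonomial.comp _ Subtype.val_injective)

end Words

end NCIS

namespace NCIS

section Clifford

variable {k : Type*} [Field k] {n : ℕ} {ω : k}

theorem sum_range_natCast_zmod [NeZero n] {M : Type*} [AddCommMonoid M] (f : ℕ → ZMod n → M) :
    ∑ i ∈ Finset.range n, f i (i : ZMod n) = ∑ i : ZMod n, f i.val i := by
  refine Finset.sum_bij' (fun i _ => (i : ZMod n)) (fun i _ => i.val) ?_ ?_ ?_ ?_ ?_
  · simp
  · intro i _
    simpa using ZMod.val_lt i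
  · intro i hi
    exact ZMod.val_cast_of_lt (Finset.mem_range.mp hi)
  · simp
  · intro i hi
    rw [ZMod.val_cast_of_lt (Finset.mem_range.mp hi)]

theorem bA_eq_sum [NeZero n] (γ : ZMod n) :
    bA k n ω γ = (n : k)⁻¹ • ∑ i : ZMod n, ω ^ (i.val * γ.val) • xA k n i := by
  rw [bA, sum_range_natCast_zmod fun i z => ω ^ (i * γ.val) • xA k n z]

theorem cA_eq_sum [NeZero n] (j : ZMod n) :
    cA k n ω j = (2 / (n : k) ^ 2) • ∑ i : ZMod n, ω ^ (i.val * j.val) • xA k n i ^ 2 := by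
  rw [cA, sum_range_natCast_zmod fun i z => ω ^ (i * j.val) • xA k n z ^ 2]

theorem bA_mem_span_xA [NeZero n] (γ : ZMod n) :
    bA k n ω γ ∈ Submodule.span k (Set.range (xA k n)) := by
  rw [bA_eq_sum]
  exact Submodule.smul_mem _ _ (Submodule.sum_mem _ fun i _ =>
    Submodule.smul_mem _ _ (Submodule.subset_span ⟨i, rfl⟩))

theorem cA_mem_span_xA_sq [NeZero n] (j : ZMod n) :
    cA k n ω j ∈ Submodule.span k (Set.range (xA k n)) ^ 2 := by
  have hx : ∀ i, xA k n i ∈ Submodule.span k (Set.range (xA k n)) := fun i =>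
    Submodule.subset_span ⟨i, rfl⟩
  rw [cA_eq_sum]
  exact Submodule.smul_mem _ _ (Submodule.sum_mem _ fun i _ =>
    Submodule.smul_mem _ _ (Submodule.pow_mem_pow _ (hx i) 2))

theorem pow_mul_val_add (hω : IsPrimitiveRoot ω n) [NeZero n] (i : ℕ) (γ δ : ZMod n) :
    ω ^ (i * (γ + δ).val) = ω ^ (i * γ.val) * ω ^ (i * δ.val) := by
  have hn : (ω ^ i) ^ n = 1 := by rw [← pow_mul, mul_comm, pow_mul, hω.pow_eq_one, one_pow]
  rw [ZMod.val_add, pow_mul, ← pow_eq_pow_mod _ hn, pow_add, pow_mul, pow_mul]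

theorem sum_pow_mul_inv_pow (hω : IsPrimitiveRoot ω n) [NeZero n] (i j : ZMod n) :
    ∑ γ : ZMod n, ω ^ (j.val * γ.val) * (ω ^ (i.val * γ.val))⁻¹ = if j = i then (n : k) else 0 := by
  have hω0 : ω ≠ 0 := hω.ne_zero (NeZero.ne n)
  set ζ : k := ω ^ j.val * (ω ^ i.val)⁻¹ with hζ
  have hterm : ∀ m : ℕ, ω ^ (j.val * m) * (ω ^ (i.val * m))⁻¹ = ζ ^ m := fun m => by
    rw [hζ, mul_pow, inv_pow, ← pow_mul, ← pow_mul]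
  simp_rw [hterm]
  rw [← sum_range_natCast_zmod (n := n) fun m _ => ζ ^ m]
  split_ifs with h
  · have : ζ = 1 := by rw [hζ, h, mul_inv_cancel₀ (pow_ne_zero _ hω0)]
    simp [this]
  · have hne : ζ - 1 ≠ 0 := by
      intro hc
      have h1 : ω ^ j.val = ω ^ i.val := by
        rw [sub_eq_zero, hζ, mul_inv_eq_one₀ (pow_ne_zero _ hω0)] at hc
        exact hc
      exact h (ZMod.val_injective n (hω.pow_inj (ZMod.val_lt j) (ZMod.val_lt i) h1))
    have hn : ζ ^ n = 1 := by
      rw [hζ, mul_pow, inv_pow, ← pow_mul, ← pow_mul, mul_comm, mul_comm j.val, mul_comm i.val,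
        pow_mul, pow_mul, hω.pow_eq_one]
      simp
    refine (mul_eq_zero.mp ?_).resolve_left hne
    rw [mul_geom_sum, hn, sub_self]

theorem xA_eq_sum_bA [CharZero k] (hω : IsPrimitiveRoot ω n) [NeZero n] (i : ZMod n) :
    xA k n i = ∑ γ : ZMod n, (ω ^ (i.val * γ.val))⁻¹ • bA k n ω γ := by
  have hn : (n : k) ≠ 0 := Nat.cast_ne_zero.mpr (NeZero.ne n)
  have h : ∀ γ : ZMod n, (ω ^ (i.val * γ.val))⁻¹ • bA k n ω γ =
      ∑ j : ZMod n,
        ((n : k)⁻¹ * (ω ^ (j.val * γ.val) * (ω ^ (i.val * γ.val))⁻¹)) • xA k n j := fun γ => by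
    rw [bA_eq_sum, Finset.smul_sum, Finset.smul_sum]
    refine Finset.sum_congr rfl fun j _ => ?_
    rw [smul_smul, smul_smul]
    congr 1
    ring
  simp_rw [h]
  rw [Finset.sum_comm]
  simp_rw [← Finset.sum_smul, ← Finset.mul_sum, sum_pow_mul_inv_pow hω]
  simp [hn]

theorem span_range_bA [CharZero k] (hω : IsPrimitiveRoot ω n) [NeZero n] :
    Submodule.span k (Set.range (bA k n ω)) = Submodule.span k (Set.range (xA k n)) := by
  apply le_antisymm
  · rw [Submodule.span_le]
    rintro _ ⟨γ, rfl⟩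
    exact bA_mem_span_xA γ
  · rw [Submodule.span_le]
    rintro _ ⟨i, rfl⟩
    rw [xA_eq_sum_bA hω i]
    exact Submodule.sum_mem _ fun γ _ => Submodule.smul_mem _ _ (Submodule.subset_span ⟨γ, rfl⟩)

theorem bA_mul_bA_add (hω : IsPrimitiveRoot ω n) [NeZero n] (γ δ : ZMod n) :
    bA k n ω γ * bA k n ω δ + bA k n ω δ * bA k n ω γ = cA k n ω (γ + δ) := by
  have hx : ∀ i j : ZMod n, xA k n i * xA k n j + xA k n j * xA k n i =
      if i = j then (2 : k) • xA k n i ^ 2 else 0 := fun i j => by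
    split_ifs with h
    · rw [h, ← sq, two_smul]
    · exact xA_mul_xA_add_of_ne h
  have hsum : (∑ i : ZMod n, ω ^ (i.val * γ.val) • xA k n i) *
        (∑ j : ZMod n, ω ^ (j.val * δ.val) • xA k n j) +
      (∑ j : ZMod n, ω ^ (j.val * δ.val) • xA k n j) *
        (∑ i : ZMod n, ω ^ (i.val * γ.val) • xA k n i) =
      ∑ i : ZMod n, ∑ j : ZMod n, (ω ^ (i.val * γ.val) * ω ^ (j.val * δ.val)) •
        (xA k n i * xA k n j + xA k n j * xA k n i) := by
    rw [Finset.sum_mul_sum, Finset.sum_mul_sum, Finset.sum_comm (s := Finset.univ (α := ZMod n))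
      (f := fun j i => ω ^ (j.val * δ.val) • xA k n j * ω ^ (i.val * γ.val) • xA k n i),
      ← Finset.sum_add_distrib]
    refine Finset.sum_congr rfl fun i _ => ?_
    rw [← Finset.sum_add_distrib]
    refine Finset.sum_congr rfl fun j _ => ?_
    rw [smul_mul_smul_comm, smul_mul_smul_comm, smul_add,
      mul_comm (ω ^ (j.val * δ.val)) (ω ^ (i.val * γ.val))]
  rw [bA_eq_sum, bA_eq_sum, smul_mul_smul_comm, smul_mul_smul_comm, ← smul_add, hsum, cA_eq_sum]
  simp_rw [hx, smul_ite, smul_zero, Finset.sum_ite_eq, Finset.mem_univ, if_true,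
    pow_mul_val_add hω, Finset.smul_sum, smul_smul]
  refine Finset.sum_congr rfl fun i _ => ?_
  congr 1
  rw [div_eq_mul_inv, sq, mul_inv]
  ring

theorem xA_sq_commute (i j : ZMod n) : Commute (xA k n i ^ 2) (xA k n j) := by
  by_cases h : i = j
  · rw [h]
    exact (Commute.refl _).pow_left 2
  · rw [Commute, SemiconjBy, sq, mul_assoc, xA_mul_xA_of_ne h, mul_smul_comm, ← mul_assoc,
      xA_mul_xA_of_ne h, smul_mul_assoc, smul_smul, mul_assoc, neg_mul_neg, one_mul, one_smul]

theorem cA_mem_center [NeZero n] (j : ZMod n) :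
    cA k n ω j ∈ Subalgebra.center k (SkewPoly k n) := by
  rw [cA_eq_sum]
  refine Subalgebra.smul_mem _ (Subalgebra.sum_mem _ fun i _ => Subalgebra.smul_mem _ ?_ _) _
  rw [Subalgebra.mem_center_iff]
  intro a
  have ha : a ∈ ⨆ r, Adeg k n r := by rw [iSup_Adeg]; trivial
  induction ha using Submodule.iSup_induction' with
  | mem r y hy =>
    induction hy using Submodule.span_induction with
    | mem y hy =>
      obtain ⟨w, rfl⟩ := hy
      refine (Commute.list_prod_right _ _ fun z hz => ?_).symm.eq
      obtain ⟨t, rfl⟩ := (List.mem_ofFn' _ _).mp hz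
      exact xA_sq_commute i _
    | zero => simp
    | add y z _ _ hy hz => rw [add_mul, mul_add, hy, hz]
    | smul a y _ hy => rw [smul_mul_assoc, mul_smul_comm, hy]
  | zero => simp
  | add y z _ _ hy hz => rw [add_mul, mul_add, hy, hz]

end Clifford

end NCIS

namespace NCIS

section Straightening

variable {k : Type*} [Field k] {n : ℕ} {ω : k}

variable (k n) in
/-- The monomial `c_0^{j_0} ⋯ c_{n−1}^{j_{n−1}}`. -/
noncomputable def cMonomial (ω : k) (j : Fin n → ℕ) : SkewPoly k n :=
  (List.ofFn fun t : Fin n => cA k n ω ((t : ℕ) : ZMod n) ^ j t).prod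

variable (k n) in
/-- The product `b_{w_1} ⋯ b_{w_m}` along a word `w`. -/
noncomputable def bWord (ω : k) (w : List (Fin n)) : SkewPoly k n :=
  (w.map fun t : Fin n => bA k n ω ((t : ℕ) : ZMod n)).prod

variable (k n) in
/-- The span of the monomials `𝐛^𝐢 𝐜^𝐣` of degree `r` with `𝐢 ∈ {0,1}ⁿ`. -/
noncomputable abbrev bcSpan (ω : k) (r : ℕ) : Submodule k (SkewPoly k n) :=
  Submodule.span k
    (Set.range
      (fun p : {p : (Fin n → ℕ) × (Fin n → ℕ) //
          (∀ t, p.1 t ≤ 1) ∧ (∑ t, p.1 t) + 2 * ∑ t, p.2 t = r} =>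
        bcMonomial k n ω p.1))

theorem cMonomial_eq_coe_prod [NeZero n] (j : Fin n → ℕ) :
    cMonomial k n ω j =
      ((∏ t : Fin n, (⟨cA k n ω ((t : ℕ) : ZMod n), cA_mem_center _⟩ :
        Subalgebra.center k (SkewPoly k n)) ^ j t : Subalgebra.center k (SkewPoly k n)) :
          SkewPoly k n) := by
  rw [← List.prod_ofFn, ← Subalgebra.coe_val, map_list_prod, List.map_ofFn, cMonomial]
  rfl

theorem cA_mul_cMonomial [NeZero n] (γ : ZMod n) (j : Fin n → ℕ) :
    cA k n ω γ * cMonomial k n ω j =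
      cMonomial k n ω (j + Pi.single ⟨γ.val, ZMod.val_lt γ⟩ 1) := by
  have hγ : (⟨cA k n ω γ, cA_mem_center γ⟩ : Subalgebra.center k (SkewPoly k n)) =
      ∏ t : Fin n, (⟨cA k n ω ((t : ℕ) : ZMod n), cA_mem_center _⟩ :
        Subalgebra.center k (SkewPoly k n)) ^
          (Pi.single (⟨γ.val, ZMod.val_lt γ⟩ : Fin n) 1 : Fin n → ℕ) t := by
    rw [Finset.prod_eq_single (⟨γ.val, ZMod.val_lt γ⟩ : Fin n)]
    · simp
    · intro t _ ht
      rw [Pi.single_eq_of_ne ht, pow_zero]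
    · simp
  rw [cMonomial_eq_coe_prod, cMonomial_eq_coe_prod]
  simp_rw [Pi.add_apply, pow_add, Finset.prod_mul_distrib]
  rw [← hγ, mul_comm (Finset.prod _ _)]
  rfl

theorem bWord_append (u v : List (Fin n)) :
    bWord k n ω (u ++ v) = bWord k n ω u * bWord k n ω v := by
  simp [bWord]

theorem bWord_swap_add [NeZero n] (hω : IsPrimitiveRoot ω n) (s t : Fin n)
    (u v : List (Fin n)) (j : Fin n → ℕ) :
    bWord k n ω (u ++ s :: t :: v) * cMonomial k n ω j +
        bWord k n ω (u ++ t :: s :: v) * cMonomial k n ω j =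
      bWord k n ω (u ++ v) * cMonomial k n ω (j + Pi.single
        ⟨(((s : ℕ) : ZMod n) + ((t : ℕ) : ZMod n)).val, ZMod.val_lt _⟩ 1) := by
  have hc := Subalgebra.mem_center_iff.mp
    (cA_mem_center (k := k) (ω := ω) (((s : ℕ) : ZMod n) + ((t : ℕ) : ZMod n)))
    (bWord k n ω v)
  rw [← cA_mul_cMonomial, ← mul_assoc, bWord_append u v, mul_assoc (bWord k n ω u), hc,
    ← bA_mul_bA_add hω, ← add_mul, bWord_append, bWord_append, ← mul_add]
  simp only [bWord, List.map_cons, List.prod_cons, add_mul, mul_assoc]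

/-- A word in the `b_t` straightens if all its products with monomials in the `c_t` lie in
the span of the ordered monomials of the appropriate degree. -/
def Straightens (ω : k) (w : List (Fin n)) : Prop :=
  ∀ (j : Fin n → ℕ) (r : ℕ), w.length + 2 * ∑ t, j t = r →
    bWord k n ω w * cMonomial k n ω j ∈ bcSpan k n ω r

theorem Straightens.swap_add_mem [NeZero n] (hω : IsPrimitiveRoot ω n) {s t : Fin n}
    {u v : List (Fin n)} (huv : Straightens ω (u ++ v)) {j : Fin n → ℕ} {r : ℕ}
    (hr : (u ++ s :: t :: v).length + 2 * ∑ t, j t = r) :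
    bWord k n ω (u ++ s :: t :: v) * cMonomial k n ω j +
      bWord k n ω (u ++ t :: s :: v) * cMonomial k n ω j ∈ bcSpan k n ω r := by
  rw [bWord_swap_add hω]
  refine huv _ _ ?_
  simp only [Pi.add_apply, Finset.sum_add_distrib, Finset.sum_pi_single', Finset.mem_univ,
    if_true]
  simp only [List.length_append, List.length_cons] at hr ⊢
  omega

theorem Straightens.of_perm [NeZero n] (hω : IsPrimitiveRoot ω n) {w w' : List (Fin n)}
    (h : w.Perm w') (u : List (Fin n))
    (ih : ∀ v : List (Fin n), v.length < (u ++ w).length → Straightens ω v)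
    (hw : Straightens ω (u ++ w)) : Straightens ω (u ++ w') := by
  induction h generalizing u with
  | nil => exact hw
  | cons a _ ih' =>
    have := ih' (u ++ [a]) (by simpa using ih) (by simpa using hw)
    simpa using this
  | swap s t l =>
    intro j r hr
    have huv : Straightens ω (u ++ l) := ih _ (by simp)
    refine (Submodule.add_mem_iff_left _ (hw j r ?_)).mp (huv.swap_add_mem hω hr)
    simpa using hr
  | trans h₁ _ ih₁ ih₂ =>
    refine ih₂ u ?_ (ih₁ u ih hw)
    simpa [h₁.length_eq] using ih

theorem Straightens.filter_finRange (ω : k) (s : Finset (Fin n)) :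
    Straightens ω ((List.finRange n).filter (· ∈ s)) := by
  intro j r hr
  refine Submodule.subset_span ⟨⟨(fun t => if t ∈ s then 1 else 0, j), ?_, ?_⟩, ?_⟩
  · intro t
    dsimp only
    split_ifs <;> omega
  · have hlen : ((List.finRange n).filter (· ∈ s)).length = s.card := by
      rw [← List.toFinset_card_of_nodup ((List.nodup_finRange n).filter _)]
      congr 1
      ext t
      simp
    rw [hlen] at hr
    simpa using hr
  · have hb : ∀ l : List (Fin n),
        (l.map fun t : Fin n => bA k n ω ((t : ℕ) : ZMod n) ^ (if t ∈ s then 1 else 0)).prod =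
          bWord k n ω (l.filter (· ∈ s)) := fun l => by
      induction l with
      | nil => simp [bWord]
      | cons t l ih =>
        rw [List.map_cons, List.prod_cons, ih]
        by_cases ht : t ∈ s <;> simp [bWord, ht]
    rw [← hb, ← List.ofFn_eq_map]
    rfl

theorem straightens [CharZero k] [NeZero n] (hω : IsPrimitiveRoot ω n) (w : List (Fin n)) :
    Straightens ω w := by
  induction hN : w.length using Nat.strong_induction_on generalizing w with
  | _ N ih =>
    have ih' : ∀ v : List (Fin n), v.length < w.length → Straightens ω v :=
      fun v hv => ih _ (hN ▸ hv) v rfl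
    by_cases hw : w.Nodup
    · have hp : ((List.finRange n).filter (· ∈ w.toFinset)).Perm w := by
        refine (List.perm_ext_iff_of_nodup ((List.nodup_finRange n).filter _) hw).mpr ?_
        simp
      exact Straightens.of_perm hω hp [] (by rwa [List.nil_append, hp.length_eq])
        (Straightens.filter_finRange ω _)
    · obtain ⟨t, ht⟩ := List.exists_duplicate_iff_not_nodup.mpr hw
      obtain ⟨v, hv⟩ := (List.duplicate_iff_sublist.mp ht).exists_perm_append
      have hlen := hv.length_eq
      refine Straightens.of_perm hω hv.symm [] (by rwa [List.nil_append, ← hlen]) ?_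
      intro j r hr
      have hv' : Straightens ω ([] ++ v) := ih' _ (by simp [hlen])
      have h2 := hv'.swap_add_mem hω (s := t) (t := t) (j := j) (r := r) (by simpa using hr)
      rw [← two_smul k] at h2
      exact (Submodule.smul_mem_iff _ two_ne_zero).mp h2

theorem bcSpan_eq_Adeg [CharZero k] [NeZero n] (hω : IsPrimitiveRoot ω n) (r : ℕ) :
    bcSpan k n ω r = Adeg k n r := by
  apply le_antisymm
  · rw [bcSpan, Submodule.span_le]
    rintro _ ⟨⟨p, hp, rfl⟩, rfl⟩
    rw [Adeg_eq_span_range_pow]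
    set M := Submodule.span k (Set.range (xA k n)) with hM
    have h₁ := SetLike.list_prod_ofFn_mem_graded (A := fun i : ℕ => M ^ i) p.1
      (fun t => bA k n ω ((t : ℕ) : ZMod n) ^ p.1 t)
      (fun t => Submodule.pow_mem_pow M (bA_mem_span_xA _) _)
    have h₂ := SetLike.list_prod_ofFn_mem_graded (A := fun i : ℕ => M ^ i) (fun t => 2 * p.2 t)
      (fun t => cA k n ω ((t : ℕ) : ZMod n) ^ p.2 t)
      (fun t => by
        rw [pow_mul]
        exact Submodule.pow_mem_pow (M ^ 2) (cA_mem_span_xA_sq _) _)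
    rw [List.sum_ofFn] at h₁ h₂
    rw [← Finset.mul_sum] at h₂
    rw [SetLike.mem_coe, pow_add]
    exact Submodule.mul_mem_mul h₁ h₂
  · rw [Adeg_eq_span_range_pow, ← span_range_bA hω, Submodule.span_pow, Submodule.span_le]
    intro y hy
    obtain ⟨f, rfl⟩ := Set.mem_pow.mp hy
    choose γ hγ using fun t => (f t).2
    have h := straightens hω (List.ofFn fun t => (⟨(γ t).val, ZMod.val_lt _⟩ : Fin n)) 0 r
      (by simp)
    have hc : cMonomial k n ω 0 = 1 := by simp [cMonomial_eq_coe_prod]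
    rw [hc, mul_one, bWord, List.map_ofFn] at h
    simpa [Function.comp_def, hγ] using h

end Straightening

section Counting

/-- Exponent vectors of the monomials `𝐛^𝐢 𝐜^𝐣` of degree `r` correspond to vectors
`𝐢 + 2𝐣` of sum `r`. -/
def bcIndexEquiv (n r : ℕ) :
    {p : (Fin n → ℕ) × (Fin n → ℕ) //
      (∀ t, p.1 t ≤ 1) ∧ (∑ t, p.1 t) + 2 * ∑ t, p.2 t = r} ≃
    {P : Fin n → ℕ // ∑ t, P t = r} where
  toFun p := ⟨fun t => p.1.1 t + 2 * p.1.2 t, by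
    rw [Finset.sum_add_distrib, ← Finset.mul_sum, p.2.2]⟩
  invFun P := ⟨(fun t => P.1 t % 2, fun t => P.1 t / 2), fun t => by
      dsimp only
      omega, by
    dsimp only
    rw [Finset.mul_sum, ← Finset.sum_add_distrib]
    exact (Finset.sum_congr rfl fun t _ => Nat.mod_add_div _ _).trans P.2⟩
  left_inv p := by
    refine Subtype.ext (Prod.ext (funext fun t => ?_) (funext fun t => ?_)) <;>
    · have := p.2.1 t
      dsimp only
      omega
  right_inv P := Subtype.ext (funext fun t => Nat.mod_add_div _ _)

variable {k : Type*} [Field k] {n : ℕ} {ω : k}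

theorem linearIndependent_bcMonomial [CharZero k] [NeZero n] (hω : IsPrimitiveRoot ω n)
    (r : ℕ) :
    LinearIndependent k
      (fun p : {p : (Fin n → ℕ) × (Fin n → ℕ) //
          (∀ t, p.1 t ≤ 1) ∧ (∑ t, p.1 t) + 2 * ∑ t, p.2 t = r} =>
        bcMonomial k n ω p.1) := by
  let e := (bcIndexEquiv n r).trans (Sym.equivNatSumOfFintype (Fin n) r).symm
  let _ := Fintype.ofEquiv _ e.symm
  rw [linearIndependent_iff_card_eq_finrank_span, Fintype.card_congr e]
  change _ = Module.finrank k (bcSpan k n ω r)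
  rw [bcSpan_eq_Adeg hω, finrank_Adeg, Sym.card_sym_eq_multichoose, Sym.card_sym_eq_multichoose,
    Fintype.card_fin, ZMod.card]

theorem linearIndependent_bcMonomial_total [CharZero k] [NeZero n] (hω : IsPrimitiveRoot ω n) :
    LinearIndependent k
      (fun p : {p : (Fin n → ℕ) × (Fin n → ℕ) // ∀ t, p.1 t ≤ 1} =>
        bcMonomial k n ω p.1) := by
  have hint : DirectSum.IsInternal (bcSpan k n ω) := by
    rw [funext (bcSpan_eq_Adeg hω)]
    exact isInternal_Adeg
  have hli := (hint.collectedBasis fun r =>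
    Module.Basis.span (linearIndependent_bcMonomial hω r)).linearIndependent
  let e : {p : (Fin n → ℕ) × (Fin n → ℕ) // ∀ t, p.1 t ≤ 1} →
      Σ r : ℕ, {p : (Fin n → ℕ) × (Fin n → ℕ) //
        (∀ t, p.1 t ≤ 1) ∧ (∑ t, p.1 t) + 2 * ∑ t, p.2 t = r} :=
    fun p => ⟨_, ⟨p.1, p.2, rfl⟩⟩
  have he : Function.Injective e := fun p q h =>
    Subtype.ext (congrArg (fun z => z.2.1) h)
  convert hli.comp e he using 1
  funext p
  rw [Function.comp_apply, DirectSum.IsInternal.collectedBasis_coe]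
  exact congrArg Subtype.val
    (Module.Basis.span_apply (linearIndependent_bcMonomial hω _) (e p).2).symm

theorem span_bcMonomial_total [CharZero k] [NeZero n] (hω : IsPrimitiveRoot ω n) :
    Submodule.span k
      (Set.range
        (fun p : {p : (Fin n → ℕ) × (Fin n → ℕ) // ∀ t, p.1 t ≤ 1} =>
          bcMonomial k n ω p.1)) = ⊤ := by
  rw [eq_top_iff, ← iSup_Adeg]
  refine iSup_le fun r => ?_
  rw [← bcSpan_eq_Adeg hω]
  refine Submodule.span_mono ?_
  rintro _ ⟨p, rfl⟩
  exact ⟨⟨p.1, p.2.1⟩, rfl⟩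

end Counting

end NCIS

open NCIS in
/-- Proposition 1.2 and Corollary 1.3(1): `A` carries an ℕ-grading with
each `x_i` of degree `1`; for each `r ≥ 0` the monomials `𝐛^𝐢 𝐜^𝐣` with
`𝐢 ∈ {0,1}ⁿ`, `𝐣 ∈ ℕⁿ` and `|𝐢|₁ + 2|𝐣|₁ = r` form a `k`-basis of `A_r`; and in
particular all such monomials form a `k`-basis of `A`. -/
theorem basis_of_skewPoly_homogeneous_component
    (k : Type*) [Field k] [IsAlgClosed k] [CharZero k]
    (n : ℕ) (hn2 : 2 ≤ n) (ω : k) (hω : IsPrimitiveRoot ω n) :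
    (∀ i : ZMod n, xA k n i ∈ Adeg k n 1) ∧
    (∀ r s : ℕ, Adeg k n r * Adeg k n s ≤ Adeg k n (r + s)) ∧
    DirectSum.IsInternal (Adeg k n) ∧
    (∀ r : ℕ,
      LinearIndependent k
        (fun p : {p : (Fin n → ℕ) × (Fin n → ℕ) //
            (∀ t, p.1 t ≤ 1) ∧ (∑ t, p.1 t) + 2 * ∑ t, p.2 t = r} =>
          bcMonomial k n ω p.1) ∧
      Submodule.span k
          (Set.range
            (fun p : {p : (Fin n → ℕ) × (Fin n → ℕ) //
                (∀ t, p.1 t ≤ 1) ∧ (∑ t, p.1 t) + 2 * ∑ t, p.2 t = r} =>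
              bcMonomial k n ω p.1)) = Adeg k n r) ∧
    (LinearIndependent k
        (fun p : {p : (Fin n → ℕ) × (Fin n → ℕ) // ∀ t, p.1 t ≤ 1} =>
          bcMonomial k n ω p.1) ∧
      Submodule.span k
          (Set.range
            (fun p : {p : (Fin n → ℕ) × (Fin n → ℕ) // ∀ t, p.1 t ≤ 1} =>
              bcMonomial k n ω p.1)) = ⊤) := by
  have : NeZero n := ⟨by omega⟩
  refine ⟨fun i => ?_, fun r s => ?_, isInternal_Adeg, fun r =>
    ⟨linearIndependent_bcMonomial hω r, bcSpan_eq_Adeg hω r⟩,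
    linearIndependent_bcMonomial_total hω, span_bcMonomial_total hω⟩
  · rw [Adeg_eq_span_range_pow, pow_one]
    exact Submodule.subset_span ⟨i, rfl⟩
  · simp_rw [Adeg_eq_span_range_pow, pow_add]
    exact le_rfl
end

section
/- For all α, m ∈ ℤ/nℤ and every integer N ≥ 1, one has e_α c_m^N ∈ (e_{α−m}) and e_α c_m^N ∈ (e₀) + (e_{2α−m}), where (x) denotes the two-sided ideal of A#C_n generated by the element x. -/
open scoped BigOperators

namespace NCIS

variable (k : Type*) [Field k] (n : ℕ)

/-- The eigenvector `b_γ = (1/n) ∑_{i=0}^{n-1} ω^{iγ} x_i` in `A ⊆ A # C_n`. -/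
noncomputable def bg (ω : k) (γ : ZMod n) : SkewGroup k n :=
  (n : k)⁻¹ • ∑ i ∈ Finset.range n, ω ^ (i * γ.val) • xg k n (i : ZMod n)

/-- The central element `c_j = (2/n²) ∑_{i=0}^{n-1} ω^{ij} x_i²` of `A ⊆ A # C_n`. -/
noncomputable def cg (ω : k) (j : ZMod n) : SkewGroup k n :=
  (2 / (n : k) ^ 2) • ∑ i ∈ Finset.range n, ω ^ (i * j.val) • xg k n (i : ZMod n) ^ 2

/-- The idempotent `e_α = (1/n) ∑_{i=0}^{n-1} (ω^α s)^i` in `A # C_n`. -/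
noncomputable def eg (ω : k) (α : ZMod n) : SkewGroup k n :=
  (n : k)⁻¹ • ∑ i ∈ Finset.range n, (ω ^ α.val • sg k n) ^ i

end NCIS

namespace NCIS

section

variable {k : Type*} [Field k] {n : ℕ}

lemma xg_anticomm {i j : ZMod n} (h : i ≠ j) :
    xg k n i * xg k n j + xg k n j * xg k n i = 0 := by
  simpa [xg] using RingQuot.mkAlgHom_rel k (SGRel.anti (k := k) i j h)

lemma sg_mul_xg (i : ZMod n) : sg k n * xg k n i = xg k n (i + 1) * sg k n := by
  simpa [xg, sg] using RingQuot.mkAlgHom_rel k (SGRel.scomm (k := k) i)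

lemma sg_mul_xg_sq (i : ZMod n) :
    sg k n * xg k n i ^ 2 = xg k n (i + 1) ^ 2 * sg k n := by
  rw [pow_two, ← mul_assoc, sg_mul_xg, mul_assoc, sg_mul_xg, ← mul_assoc, ← pow_two]

lemma e0_eq_eg_zero (ω : k) : e0 k n = eg k n ω 0 := by
  simp [e0, eg]

variable {ω : k}

lemma pow_eq_pow_of_natCast_eq (hω : IsPrimitiveRoot ω n) {a b : ℕ}
    (h : (a : ZMod n) = b) : ω ^ a = ω ^ b := by
  rw [ZMod.natCast_eq_natCast_iff] at h
  rw [← pow_mod_orderOf, ← pow_mod_orderOf ω b, ← hω.eq_orderOf, h]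

lemma eg_mul_of_semiconjBy {α β : ZMod n} {b : SkewGroup k n}
    (h : SemiconjBy b (ω ^ β.val • sg k n) (ω ^ α.val • sg k n)) :
    eg k n ω α * b = b * eg k n ω β := by
  simp only [eg, smul_mul_assoc, mul_smul_comm, Finset.sum_mul, Finset.mul_sum]
  congr 1
  exact Finset.sum_congr rfl fun i _ => (h.pow_right i).eq.symm

variable [NeZero n]

lemma sum_range_eq_sum_zmod {M : Type*} [AddCommMonoid M] [Module k M]
    (ω : k) (γ : ZMod n) (f : ZMod n → M) :
    ∑ i ∈ Finset.range n, ω ^ (i * γ.val) • f i = ∑ z : ZMod n, ω ^ (z.val * γ.val) • f z := by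
  refine Finset.sum_bij' (fun i _ => (i : ZMod n)) (fun z _ => z.val) (by simp)
    (fun z _ => Finset.mem_range.2 z.val_lt)
    (fun i hi => ZMod.val_cast_of_lt (Finset.mem_range.1 hi)) (by simp) ?_
  intro i hi
  rw [ZMod.val_cast_of_lt (Finset.mem_range.1 hi)]

/-- The Fourier transform of a family that `s` shifts shifts the characters of `s`. -/
lemma semiconjBy_sum_smul (hω : IsPrimitiveRoot ω n) (α γ : ZMod n)
    {f : ZMod n → SkewGroup k n} (hf : ∀ i, sg k n * f i = f (i + 1) * sg k n) :
    SemiconjBy (∑ i ∈ Finset.range n, ω ^ (i * γ.val) • f i)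
      (ω ^ (α - γ).val • sg k n) (ω ^ α.val • sg k n) := by
  rw [sum_range_eq_sum_zmod ω, SemiconjBy, Finset.sum_mul, Finset.mul_sum,
    ← Equiv.sum_comp (Equiv.addRight (1 : ZMod n))]
  refine Finset.sum_congr rfl fun i _ => ?_
  simp only [Equiv.coe_addRight, smul_mul_smul_comm, hf, ← pow_add]
  congr 1
  apply pow_eq_pow_of_natCast_eq hω
  push_cast [ZMod.natCast_zmod_val]
  ring

lemma eg_mul_bg (hω : IsPrimitiveRoot ω n) (α γ : ZMod n) :
    eg k n ω α * bg k n ω γ = bg k n ω γ * eg k n ω (α - γ) := by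
  rw [bg, mul_smul_comm, smul_mul_assoc,
    eg_mul_of_semiconjBy (semiconjBy_sum_smul hω α γ sg_mul_xg)]

lemma eg_mul_cg (hω : IsPrimitiveRoot ω n) (α m : ZMod n) :
    eg k n ω α * cg k n ω m = cg k n ω m * eg k n ω (α - m) := by
  rw [cg, mul_smul_comm, smul_mul_assoc,
    eg_mul_of_semiconjBy (semiconjBy_sum_smul hω α m sg_mul_xg_sq)]

lemma bg_mul_bg_add (hω : IsPrimitiveRoot ω n) (l m : ZMod n) :
    bg k n ω l * bg k n ω (m - l) + bg k n ω (m - l) * bg k n ω l = cg k n ω m := by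
  have hc : cg k n ω m = (2 / (n : k) ^ 2) •
      ∑ i : ZMod n, ω ^ (i.val * m.val) • xg k n i ^ 2 := by
    rw [cg, sum_range_eq_sum_zmod ω m fun i => xg k n i ^ 2]
  rw [hc, bg, bg, sum_range_eq_sum_zmod ω l, sum_range_eq_sum_zmod ω (m - l),
    smul_mul_smul_comm, smul_mul_smul_comm, ← smul_add, ← mul_inv, ← pow_two, div_eq_inv_mul,
    mul_smul _ (2 : k)]
  congr 1
  rw [Finset.sum_mul_sum, Finset.sum_mul_sum,
    Finset.sum_comm (f := fun i j => (ω ^ (i.val * (m - l).val) • xg k n i) *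
      (ω ^ (j.val * l.val) • xg k n j)), ← Finset.sum_add_distrib, Finset.smul_sum]
  refine Finset.sum_congr rfl fun i _ => ?_
  rw [← Finset.sum_add_distrib, Finset.sum_eq_single i]
  · rw [smul_mul_smul_comm, smul_mul_smul_comm, mul_comm (ω ^ (i.val * (m - l).val)), ← two_smul k,
      ← pow_two, ← pow_add]
    congr 2
    apply pow_eq_pow_of_natCast_eq hω
    push_cast [ZMod.natCast_zmod_val]
    ring
  · intro j _ hj
    rw [smul_mul_smul_comm, smul_mul_smul_comm, mul_comm (ω ^ (j.val * (m - l).val)), ← smul_add,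
      xg_anticomm hj.symm, smul_zero]
  · simp

lemma eg_mul_cg_mem_span (hω : IsPrimitiveRoot ω n) (α m : ZMod n) :
    eg k n ω α * cg k n ω m ∈ TwoSidedIdeal.span {eg k n ω (α - m)} := by
  rw [eg_mul_cg hω]
  exact TwoSidedIdeal.mul_mem_left _ _ _ (TwoSidedIdeal.subset_span rfl)

lemma eg_mul_cg_mem_sup (hω : IsPrimitiveRoot ω n) (α m : ZMod n) :
    eg k n ω α * cg k n ω m ∈
      TwoSidedIdeal.span {e0 k n} ⊔ TwoSidedIdeal.span {eg k n ω (2 * α - m)} := by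
  have h : α - (m - α) = 2 * α - m := by ring
  rw [← bg_mul_bg_add hω α m, mul_add, ← mul_assoc, ← mul_assoc, eg_mul_bg hω, eg_mul_bg hω,
    sub_self, ← e0_eq_eg_zero, h]
  refine TwoSidedIdeal.add_mem _
    (TwoSidedIdeal.mul_mem_right _ _ _ (TwoSidedIdeal.mul_mem_left _ _ _ ?_))
    (TwoSidedIdeal.mul_mem_right _ _ _ (TwoSidedIdeal.mul_mem_left _ _ _ ?_))
  · exact (le_sup_left : TwoSidedIdeal.span {e0 k n} ≤ _) (TwoSidedIdeal.subset_span rfl)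
  · exact (le_sup_right : TwoSidedIdeal.span {eg k n ω (2 * α - m)} ≤ _)
      (TwoSidedIdeal.subset_span rfl)

end

end NCIS

open NCIS in
/-- Lemma 2.1: for all `α, m ∈ ℤ/n` and `N ≥ 1`,
`e_α c_m^N ∈ (e_{α−m})` and `e_α c_m^N ∈ (e₀) + (e_{2α−m})`, where `(x)` denotes the
two-sided ideal of `A#C_n` generated by `x`. -/
theorem e_mul_c_pow_mem_twoSidedIdeal
    (k : Type*) [Field k] [IsAlgClosed k] [CharZero k]
    (n : ℕ) (hn2 : 2 ≤ n) (ω : k) (hω : IsPrimitiveRoot ω n)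
    (α m : ZMod n) (N : ℕ) (hN : 1 ≤ N) :
    eg k n ω α * cg k n ω m ^ N ∈ TwoSidedIdeal.span {eg k n ω (α - m)} ∧
    eg k n ω α * cg k n ω m ^ N ∈
      TwoSidedIdeal.span {e0 k n} ⊔ TwoSidedIdeal.span {eg k n ω (2 * α - m)} := by
  have : NeZero n := ⟨by omega⟩
  obtain ⟨N, rfl⟩ := Nat.exists_eq_add_of_le' hN
  rw [pow_succ', ← mul_assoc]
  exact ⟨TwoSidedIdeal.mul_mem_right _ _ _ (eg_mul_cg_mem_span hω α m),
    TwoSidedIdeal.mul_mem_right _ _ _ (eg_mul_cg_mem_sup hω α m)⟩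
end

section
/- For n = 3, GKdim E = 1; equivalently, the pertinency p(A, C₃) = 3 − GKdim E equals 2. -/
open scoped BigOperators

namespace NCIS

variable (k : Type*) [Field k] (n : ℕ)

/-- The Gelfand–Kirillov dimension of an algebra `B` with respect to a generating
subspace `V ∋ 1`:  `limsup_{m → ∞} log(dim_k V^m) / log m`, where `V^m` is the span of
all products of `m` elements of `V` (which, since `1 ∈ V`, is the span of all products of
at most `m` elements of `V`). -/
noncomputable def gkdim (B : Type*) [Ring B] [Algebra k B] (V : Submodule k B) : ℝ :=
  Filter.limsup
    (fun m : ℕ => Real.log (Module.finrank k (V ^ m : Submodule k B)) / Real.log m)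
    Filter.atTop

/-- The standard generating subspace of `E = (A#C_n)/(e₀)`: the span of `1` and of the
images of `x_0, …, x_{n-1}` and `s`. -/
noncomputable def Vgen : Submodule k (Equot k n) :=
  Submodule.span k
    (insert (1 : Equot k n)
      (insert (RingQuot.mkAlgHom k (fun a b : SkewGroup k n => a = e0 k n ∧ b = 0) (sg k n))
        (Set.range (fun i : ZMod n =>
          RingQuot.mkAlgHom k (fun a b : SkewGroup k n => a = e0 k n ∧ b = 0) (xg k n i)))))

end NCIS

namespace NCIS

open Polynomial

section CubicRelations

variable {k B : Type*} [Field k] [Ring B] [Algebra k B]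

/-- If `s y = c • y s` and `1 + s + s² = 0`, where `c` is a primitive cube root of unity, then `y`
is an eigenvector for right multiplication by `s`. -/
lemma mul_eq_smul_of_skew_comm {s y : B} {c : k} (hc : 1 + c + c ^ 2 = 0) (hc1 : c ≠ 1)
    (hs : s * s = -1 - s) (hy : s * y = c • (y * s)) : y * s = c • y := by
  have h : s * (s * y) = -y - s * y := by
    rw [← mul_assoc, hs]; noncomm_ring
  rw [hy, mul_smul_comm, ← mul_assoc, hy, smul_mul_assoc, mul_assoc, hs, mul_sub, mul_neg,
    mul_one, ← sub_eq_zero] at h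
  have h' : (1 - c) • (y * s - c • y) =
      c ^ 2 • (c • c • (-y - y * s) - (-y - c • (y * s))) := by
    match_scalars
    · linear_combination (1 - c) ^ 2 * hc
    · linear_combination c * (c - 1) * hc
  rw [h, smul_zero] at h'
  rcases smul_eq_zero.1 h' with h0 | h0
  · exact absurd (sub_eq_zero.1 h0).symm hc1
  · exact sub_eq_zero.1 h0

/-- The relations satisfied in `E` (for `n = 3`) by `s` and the `s`-eigenvectors
`y₀, y₁, y₂` of the span of the `x_i`. -/
structure EigenRelations (ω : k) (s y₀ y₁ y₂ : B) : Prop where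
  s_s : s * s = -1 - s
  s_y₀ : s * y₀ = y₀ * s
  s_y₁ : s * y₁ = ω • y₁
  s_y₂ : s * y₂ = ω ^ 2 • y₂
  y₁_s : y₁ * s = ω ^ 2 • y₁
  y₂_s : y₂ * s = ω • y₂
  y₁_y₀ : y₁ * y₀ = -(y₀ * y₁)
  y₂_y₀ : y₂ * y₀ = -(y₀ * y₂)
  y₁_y₁ : y₁ * y₁ = 0
  y₂_y₂ : y₂ * y₂ = 0
  y₁_y₂ : y₁ * y₂ = (2 / (ω - ω ^ 2)) • (y₀ ^ 2 * s - ω ^ 2 • y₀ ^ 2)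
  y₂_y₁ : y₂ * y₁ = (2 / (ω ^ 2 - ω)) • (y₀ ^ 2 * s - ω • y₀ ^ 2)

lemma eigenRelations_of_skew {ω : k} (hω : 1 + ω + ω ^ 2 = 0) (hω1 : ω ≠ 1)
    {x : ZMod 3 → B} {s : B} (hx : ∀ i j, i ≠ j → x i * x j + x j * x i = 0)
    (hs : 1 + s + s ^ 2 = 0) (hsx : ∀ i, s * x i = x (i + 1) * s) :
    EigenRelations ω s (x 0 + x 1 + x 2) (x 0 + ω • x 1 + ω ^ 2 • x 2)
      (x 0 + ω ^ 2 • x 1 + ω • x 2) := by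
  have hω3 : ω ^ 3 = 1 := by linear_combination (ω - 1) * hω
  have hω21 : ω ^ 2 ≠ 1 := fun h => hω1 (by linear_combination hω3 - ω * h)
  have hd : ω - ω ^ 2 ≠ 0 := fun h => hω1 (by linear_combination (-ω ^ 2) * h + (1 - ω) * hω3)
  have hss : s * s = -1 - s := by
    rw [← pow_two, eq_neg_of_add_eq_zero_right hs]
    abel
  have h01 : x 1 * x 0 = -(x 0 * x 1) := eq_neg_of_add_eq_zero_left (hx 1 0 (by decide))
  have h02 : x 2 * x 0 = -(x 0 * x 2) := eq_neg_of_add_eq_zero_left (hx 2 0 (by decide))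
  have h12 : x 2 * x 1 = -(x 1 * x 2) := eq_neg_of_add_eq_zero_left (hx 2 1 (by decide))
  have hs0 : s * x 0 = x 1 * s := hsx 0
  have hs1 : s * x 1 = x 2 * s := hsx 1
  have hs2 : s * x 2 = x 0 * s := hsx 2
  set y₀ := x 0 + x 1 + x 2 with hy₀
  set y₁ := x 0 + ω • x 1 + ω ^ 2 • x 2 with hy₁
  set y₂ := x 0 + ω ^ 2 • x 1 + ω • x 2 with hy₂
  have skew₁ : s * y₁ = ω ^ 2 • (y₁ * s) := by
    simp only [hy₁, mul_add, add_mul, mul_smul_comm, smul_mul_assoc, hs0, hs1, hs2]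
    match_scalars
    · linear_combination -hω3
    · linear_combination -ω * hω3
    · ring
  have skew₂ : s * y₂ = ω • (y₂ * s) := by
    simp only [hy₂, mul_add, add_mul, mul_smul_comm, smul_mul_assoc, hs0, hs1, hs2]
    match_scalars
    · linear_combination -hω3
    · ring
    · ring
  have y₁s : y₁ * s = ω ^ 2 • y₁ :=
    mul_eq_smul_of_skew_comm (by linear_combination hω + ω * hω3) hω21 hss skew₁
  have y₂s : y₂ * s = ω • y₂ := mul_eq_smul_of_skew_comm hω hω1 hss skew₂
  have sy₁ : s * y₁ = ω • y₁ := by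
    rw [skew₁, y₁s, smul_smul]
    congr 1
    linear_combination ω * hω3
  have sy₂ : s * y₂ = ω ^ 2 • y₂ := by
    rw [skew₂, y₂s, smul_smul, pow_two]
  have y₁y₁ : y₁ * y₁ = 0 := by
    have h : (ω - ω ^ 2) • (y₁ * y₁) = 0 := by
      rw [sub_smul, ← mul_smul_comm, ← sy₁, ← smul_mul_assoc, ← y₁s, mul_assoc, sub_self]
    exact (smul_eq_zero.1 h).resolve_left hd
  have y₂y₂ : y₂ * y₂ = 0 := by
    have h : (ω - ω ^ 2) • (y₂ * y₂) = 0 := by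
      rw [sub_smul, ← mul_smul_comm (ω ^ 2), ← sy₂, ← smul_mul_assoc, ← y₂s, mul_assoc, sub_self]
    exact (smul_eq_zero.1 h).resolve_left hd
  have anti₁ : y₁ * y₀ + y₀ * y₁ = (2 : k) • (y₂ * y₂) := by
    simp only [hy₀, hy₁, hy₂, mul_add, add_mul, mul_smul_comm, smul_mul_assoc, h01, h02, h12]
    match_scalars
    all_goals first | ring1 | linear_combination (-2 * ω) * hω3
  have anti₂ : y₂ * y₀ + y₀ * y₂ = (2 : k) • (y₁ * y₁) := by
    simp only [hy₀, hy₁, hy₂, mul_add, add_mul, mul_smul_comm, smul_mul_assoc, h01, h02, h12]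
    match_scalars
    all_goals first | ring1 | linear_combination (-2 * ω) * hω3
  have anti₁₂ : (2 : k) • y₀ ^ 2 = y₁ * y₂ + y₂ * y₁ := by
    rw [pow_two y₀]
    simp only [hy₀, hy₁, hy₂, mul_add, add_mul, mul_smul_comm, smul_mul_assoc, h01, h02, h12]
    match_scalars
    all_goals first | ring1 | linear_combination (-2) * hω3
  have anti₁₂s : (2 : k) • (y₀ ^ 2 * s) = ω • (y₁ * y₂) + ω ^ 2 • (y₂ * y₁) := by
    rw [← smul_mul_assoc, anti₁₂, add_mul, mul_assoc, mul_assoc, y₁s, y₂s, mul_smul_comm,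
      mul_smul_comm]
  refine ⟨hss, ?_, sy₁, sy₂, y₁s, y₂s, ?_, ?_, y₁y₁, y₂y₂, ?_, ?_⟩
  · simp only [hy₀, mul_add, add_mul, hs0, hs1, hs2]
    abel
  · rw [y₂y₂, smul_zero] at anti₁
    exact eq_neg_of_add_eq_zero_left anti₁
  · rw [y₁y₁, smul_zero] at anti₂
    exact eq_neg_of_add_eq_zero_left anti₂
  · rw [div_eq_inv_mul, mul_smul, eq_inv_smul_iff₀ hd, smul_sub, smul_comm, anti₁₂, anti₁₂s]
    module
  · rw [div_eq_inv_mul, mul_smul, eq_inv_smul_iff₀ (by rwa [← neg_sub, neg_ne_zero]), smul_sub,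
      smul_comm, anti₁₂, anti₁₂s]
    module

variable {ω : k} {s y₀ y₁ y₂ : B}

lemma EigenRelations.span_mul_le (h : EigenRelations ω s y₀ y₁ y₂) :
    Submodule.span k {1, s, y₁, y₂} * Submodule.span k {1, s, y₀, y₁, y₂} ≤
      Submodule.span k {1, y₀, y₀ ^ 2} * Submodule.span k {1, s, y₁, y₂} := by
  set W := Submodule.span k {1, y₀, y₀ ^ 2} * Submodule.span k {1, s, y₁, y₂}
  have mem : ∀ p ∈ ({1, y₀, y₀ ^ 2} : Set B), ∀ g ∈ ({1, s, y₁, y₂} : Set B), p * g ∈ W :=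
    fun p hp g hg => Submodule.mul_mem_mul (Submodule.subset_span hp) (Submodule.subset_span hg)
  simp only [Set.mem_insert_iff, Set.mem_singleton_iff, forall_eq_or_imp, forall_eq, one_mul,
    mul_one] at mem
  obtain ⟨⟨m1, ms, m₁, m₂⟩, ⟨m01, m0s, m0₁, m0₂⟩, ⟨mq, mqs, -, -⟩⟩ := mem
  rw [Submodule.span_mul_span, Submodule.span_le, Set.mul_subset_iff]
  simp only [Set.mem_insert_iff, Set.mem_singleton_iff, forall_eq_or_imp, forall_eq, one_mul,
    mul_one, SetLike.mem_coe, h.s_s, h.s_y₀, h.s_y₁, h.s_y₂, h.y₁_s, h.y₂_s, h.y₁_y₀, h.y₂_y₀,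
    h.y₁_y₁, h.y₂_y₂, h.y₁_y₂, h.y₂_y₁]
  refine ⟨⟨m1, ms, m01, m₁, m₂⟩, ⟨ms, W.sub_mem (W.neg_mem m1) ms, m0s, W.smul_mem _ m₁,
    W.smul_mem _ m₂⟩, ⟨m₁, W.smul_mem _ m₁, W.neg_mem m0₁, W.zero_mem, ?_⟩,
    ⟨m₂, W.smul_mem _ m₂, W.neg_mem m0₂, ?_, W.zero_mem⟩⟩
  all_goals exact W.smul_mem _ (W.sub_mem mqs (W.smul_mem _ mq))

lemma EigenRelations.pow_le (h : EigenRelations ω s y₀ y₁ y₂) (m : ℕ) :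
    Submodule.span k {1, s, y₀, y₁, y₂} ^ m ≤
      Submodule.span k {1, y₀, y₀ ^ 2} ^ m * Submodule.span k {1, s, y₁, y₂} := by
  induction m with
  | zero =>
    simp only [pow_zero, one_mul]
    exact Submodule.one_le.2 (Submodule.subset_span (by simp))
  | succ m ih =>
    rw [pow_succ, pow_succ, mul_assoc]
    refine (mul_le_mul_left ih _).trans ?_
    rw [mul_assoc]
    exact mul_le_mul_right h.span_mul_le _

lemma span_one_self_sq_pow_le (y : B) (m : ℕ) :
    Submodule.span k {1, y, y ^ 2} ^ m ≤
      Submodule.span k (Set.range fun i : Fin (2 * m + 1) => y ^ (i : ℕ)) := by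
  induction m with
  | zero =>
    rw [pow_zero, Submodule.one_le]
    exact Submodule.subset_span ⟨0, by simp⟩
  | succ m ih =>
    rw [pow_succ]
    refine (mul_le_mul_left ih _).trans ?_
    rw [Submodule.span_mul_span, Submodule.span_le, Set.mul_subset_iff]
    rintro _ ⟨i, rfl⟩ b hb
    apply Submodule.subset_span
    simp only [Set.mem_insert_iff, Set.mem_singleton_iff] at hb
    rcases hb with rfl | rfl | rfl
    · exact ⟨⟨i, by omega⟩, by simp⟩
    · exact ⟨⟨i + 1, by omega⟩, by simp [pow_succ]⟩
    · exact ⟨⟨i + 2, by omega⟩, by simp [pow_add]⟩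

lemma EigenRelations.finrank_pow_le (h : EigenRelations ω s y₀ y₁ y₂) {V : Submodule k B}
    (hV : V ≤ Submodule.span k {1, s, y₀, y₁, y₂}) (m : ℕ) :
    Module.finrank k (V ^ m : Submodule k B) ≤ 4 * (2 * m + 1) := by
  have hg : ({1, s, y₁, y₂} : Set B) = Set.range ![1, s, y₁, y₂] := by
    simp only [Matrix.range_cons, Matrix.range_empty, Set.union_empty, Set.singleton_union]
  have hle : V ^ m ≤ Submodule.span k (Set.range fun p : Fin (2 * m + 1) × Fin 4 =>
      y₀ ^ (p.1 : ℕ) * ![1, s, y₁, y₂] p.2) := by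
    refine (pow_le_pow_left' hV m).trans ((h.pow_le m).trans
      ((mul_le_mul_left (span_one_self_sq_pow_le y₀ m) _).trans ?_))
    rw [hg, Submodule.span_mul_span]
    refine Submodule.span_mono ?_
    rw [Set.mul_subset_iff]
    rintro _ ⟨i, rfl⟩ _ ⟨j, rfl⟩
    exact ⟨(i, j), rfl⟩
  have : FiniteDimensional k (Submodule.span k (Set.range fun p : Fin (2 * m + 1) × Fin 4 =>
      y₀ ^ (p.1 : ℕ) * ![1, s, y₁, y₂] p.2)) := .span_of_finite k (Set.finite_range _)
  refine (Submodule.finrank_mono hle).trans ((finrank_range_le_card _).trans ?_)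
  simp [mul_comm]

end CubicRelations

section Growth

variable {k B : Type*} [Field k] [Ring B] [Algebra k B]

lemma finrank_pow_ge {V : Submodule k B} (hfg : V.FG) (hV : (1 : B) ∈ V) {y : B}
    (hy : y ∈ V) {C : Type*} [Ring C] [Algebra k C] (f : B →ₐ[k] C)
    (hli : LinearIndependent k fun i : ℕ => f y ^ i) (m : ℕ) :
    m + 1 ≤ Module.finrank k (V ^ m : Submodule k B) := by
  have hmem : ∀ i : Fin (m + 1), y ^ (i : ℕ) ∈ V ^ m := fun i =>
    pow_le_pow_right' (Submodule.one_le.2 hV) (Nat.le_of_lt_succ i.2) (Submodule.pow_mem_pow V hy i)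
  have hfin : FiniteDimensional k (V ^ m : Submodule k B) :=
    Module.Finite.iff_fg.2 (hfg.pow m)
  have hli' : LinearIndependent k fun i : Fin (m + 1) => (⟨y ^ (i : ℕ), hmem i⟩ : ↥(V ^ m)) :=
    .of_comp (f.toLinearMap ∘ₗ (V ^ m).subtype)
      (by simpa [Function.comp_def] using hli.comp _ Fin.val_injective)
  simpa using hli'.fintype_card_le_finrank

/-- An algebra of linear growth has Gelfand–Kirillov dimension one. -/
lemma gkdim_eq_one_of_linear_growth {V : Submodule k B} (c : ℕ)
    (hl : ∀ m, m + 1 ≤ Module.finrank k (V ^ m : Submodule k B))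
    (hu : ∀ m, Module.finrank k (V ^ m : Submodule k B) ≤ c * (2 * m + 1)) :
    gkdim k B V = 1 := by
  have hc : 0 < c := by
    have := (hl 0).trans (hu 0)
    omega
  refine Filter.Tendsto.limsup_eq ?_
  have hlog : Filter.Tendsto (fun m : ℕ => Real.log m) Filter.atTop Filter.atTop :=
    Real.tendsto_log_atTop.comp tendsto_natCast_atTop_atTop
  have hupper : Filter.Tendsto (fun m : ℕ => Real.log (3 * c) / Real.log m + 1)
      Filter.atTop (nhds 1) := by
    simpa using (hlog.const_div_atTop (Real.log (3 * c))).add_const 1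
  refine tendsto_of_tendsto_of_tendsto_of_le_of_le' tendsto_const_nhds hupper ?_ ?_
  · filter_upwards [Filter.eventually_ge_atTop 2] with m hm
    have hm' : (2 : ℝ) ≤ m := by exact_mod_cast hm
    rw [one_le_div (Real.log_pos (by linarith))]
    refine Real.log_le_log (by linarith) ?_
    exact_mod_cast (Nat.le_succ m).trans (hl m)
  · filter_upwards [Filter.eventually_ge_atTop 2] with m hm
    have hm' : (2 : ℝ) ≤ m := by exact_mod_cast hm
    have hpos := Real.log_pos (show (1 : ℝ) < m by linarith)
    have hc' : (0 : ℝ) < c := by exact_mod_cast hc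
    rw [div_add_one hpos.ne', div_le_div_iff_of_pos_right hpos,
      ← Real.log_mul (by positivity) (by positivity)]
    refine Real.log_le_log (by exact_mod_cast (Nat.succ_pos m).trans_le (hl m)) ?_
    have : c * (2 * m + 1) ≤ 3 * c * m := by nlinarith
    exact_mod_cast (hu m).trans this

end Growth

section Quotient

variable (k : Type*) [Field k]

/-- The image of `x_i` in `E`. -/
noncomputable def xE (n : ℕ) (i : ZMod n) : Equot k n :=
  RingQuot.mkAlgHom k (fun a b : SkewGroup k n => a = e0 k n ∧ b = 0) (xg k n i)

/-- The image of `s` in `E`. -/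
noncomputable def sE (n : ℕ) : Equot k n :=
  RingQuot.mkAlgHom k (fun a b : SkewGroup k n => a = e0 k n ∧ b = 0) (sg k n)

lemma xE_anti (n : ℕ) (i j : ZMod n) (h : i ≠ j) :
    xE k n i * xE k n j + xE k n j * xE k n i = 0 := by
  have := RingQuot.mkAlgHom_rel k (SGRel.anti (k := k) i j h)
  rw [map_add, map_mul, map_mul, map_zero] at this
  rw [xE, xE, ← map_mul, ← map_mul, ← map_add, xg, xg, this, map_zero]

lemma sE_mul_xE (n : ℕ) (i : ZMod n) : sE k n * xE k n i = xE k n (i + 1) * sE k n := by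
  have := RingQuot.mkAlgHom_rel k (SGRel.scomm (k := k) i)
  rw [map_mul, map_mul] at this
  rw [xE, xE, sE, ← map_mul, ← map_mul, xg, xg, sg, this]

lemma sum_sE_pow [CharZero k] (n : ℕ) [NeZero n] : ∑ i ∈ Finset.range n, sE k n ^ i = 0 := by
  have h : RingQuot.mkAlgHom k (fun a b : SkewGroup k n => a = e0 k n ∧ b = 0) (e0 k n) =
      RingQuot.mkAlgHom k _ 0 := RingQuot.mkAlgHom_rel k ⟨rfl, rfl⟩
  have h' : (n : k)⁻¹ • ∑ i ∈ Finset.range n, sE k n ^ i =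
      RingQuot.mkAlgHom k (fun a b : SkewGroup k n => a = e0 k n ∧ b = 0) (e0 k n) := by
    simp only [sE, ← map_pow, ← map_sum, ← map_smul]
    rfl
  rw [h, map_zero] at h'
  exact (smul_eq_zero.1 h').resolve_left (inv_ne_zero (NeZero.ne _))

lemma Vgen_eq (n : ℕ) :
    Vgen k n = Submodule.span k (insert 1 (insert (sE k n) (Set.range (xE k n)))) := rfl

lemma one_mem_Vgen (n : ℕ) : 1 ∈ Vgen k n :=
  Submodule.subset_span (Set.mem_insert _ _)

lemma xE_mem_Vgen (n : ℕ) (i : ZMod n) : xE k n i ∈ Vgen k n :=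
  Submodule.subset_span (.inr (.inr ⟨i, rfl⟩))

lemma Vgen_fg (n : ℕ) [NeZero n] : (Vgen k n).FG :=
  Submodule.fg_span (((Set.finite_range _).insert _).insert _)

lemma sum_xE_mem_Vgen : (3⁻¹ : k) • (xE k 3 0 + xE k 3 1 + xE k 3 2) ∈ Vgen k 3 :=
  Submodule.smul_mem _ _ (Submodule.add_mem _ (Submodule.add_mem _ (xE_mem_Vgen k 3 0)
    (xE_mem_Vgen k 3 1)) (xE_mem_Vgen k 3 2))

lemma Vgen_three_le [CharZero k] {ω : k} (hω : 1 + ω + ω ^ 2 = 0) :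
    Vgen k 3 ≤ Submodule.span k {1, sE k 3, xE k 3 0 + xE k 3 1 + xE k 3 2,
      xE k 3 0 + ω • xE k 3 1 + ω ^ 2 • xE k 3 2,
      xE k 3 0 + ω ^ 2 • xE k 3 1 + ω • xE k 3 2} := by
  have hω3 : ω ^ 3 = 1 := by linear_combination (ω - 1) * hω
  set y₀ := xE k 3 0 + xE k 3 1 + xE k 3 2 with hy₀
  set y₁ := xE k 3 0 + ω • xE k 3 1 + ω ^ 2 • xE k 3 2 with hy₁
  set y₂ := xE k 3 0 + ω ^ 2 • xE k 3 1 + ω • xE k 3 2 with hy₂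
  set W := Submodule.span k {1, sE k 3, y₀, y₁, y₂}
  have m₀ : y₀ ∈ W := Submodule.subset_span (by simp)
  have m₁ : y₁ ∈ W := Submodule.subset_span (by simp)
  have m₂ : y₂ ∈ W := Submodule.subset_span (by simp)
  have key : ∀ a b c : k, (3⁻¹ : k) • (a • y₀ + b • y₁ + c • y₂) ∈ W := fun a b c =>
    W.smul_mem _ (W.add_mem (W.add_mem (W.smul_mem _ m₀) (W.smul_mem _ m₁)) (W.smul_mem _ m₂))
  have h3 : (3 : k) ≠ 0 := by norm_num
  rw [Vgen_eq, Submodule.span_le, Set.insert_subset_iff, Set.insert_subset_iff]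
  refine ⟨Submodule.subset_span (by simp), Submodule.subset_span (by simp), ?_⟩
  rintro _ ⟨i, rfl⟩
  rw [SetLike.mem_coe]
  have h0 : xE k 3 0 = (3⁻¹ : k) • ((1 : k) • y₀ + (1 : k) • y₁ + (1 : k) • y₂) := by
    rw [eq_inv_smul_iff₀ h3]
    match_scalars
    · ring
    · linear_combination -hω
    · linear_combination -hω
  have h1 : xE k 3 1 = (3⁻¹ : k) • ((1 : k) • y₀ + ω ^ 2 • y₁ + ω • y₂) := by
    rw [eq_inv_smul_iff₀ h3]
    match_scalars
    · linear_combination -2 * hω3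
    · linear_combination -hω
    · linear_combination -hω - ω * hω3
  have h2 : xE k 3 2 = (3⁻¹ : k) • ((1 : k) • y₀ + ω • y₁ + ω ^ 2 • y₂) := by
    rw [eq_inv_smul_iff₀ h3]
    match_scalars
    · linear_combination -2 * hω3
    · linear_combination -hω
    · linear_combination -hω - ω * hω3
  fin_cases i
  · exact h0 ▸ key _ _ _
  · exact h1 ▸ key _ _ _
  · exact h2 ▸ key _ _ _

end Quotient

section Representation

variable {k : Type*} [Field k]

/-- The matrices over `k[X]` by which the generators `x_i` and `s` act on `k[X]²`, in a
representation of `E` (for `n = 3`) whose restriction to `k[y₀]` is faithful. -/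
noncomputable def repGen (ω : k) : ZMod 3 ⊕ Unit → Matrix (Fin 2) (Fin 2) k[X]
  | .inl i => !![X, C (ω ^ i.val) * X; C (2 * ω ^ (2 * i.val)) * X, -X]
  | .inr _ => !![C (ω ^ 2), 0; 0, C ω]

lemma repGen_rel {ω : k} (hω : 1 + ω + ω ^ 2 = 0) ⦃a b : FreeAlgebra k (ZMod 3 ⊕ Unit)⦄
    (h : SGRel k 3 a b) :
    FreeAlgebra.lift k (repGen ω) a = FreeAlgebra.lift k (repGen ω) b := by
  have hω' : 1 + C ω + C ω ^ 2 = 0 := by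
    rw [← C_pow, ← C_1, ← C_add, ← C_add, hω, C_0]
  have hω3 : C ω ^ 3 = 1 := by linear_combination (C ω - 1) * hω'
  cases h with
  | anti i j hij =>
    have hij' : C ω ^ (i.val + 2 * j.val) + C ω ^ (j.val + 2 * i.val) = -1 := by
      revert hij
      fin_cases i <;> fin_cases j <;> simp [ZMod.val]
      all_goals
        intro hij
        first
          | exact absurd rfl hij
          | linear_combination hω'
          | linear_combination hω' + C ω * hω3
          | linear_combination hω' + (C ω + C ω ^ 2) * hω3
    have hC2 : (C 2 : k[X]) = 2 := map_ofNat C 2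
    simp only [map_add, map_mul, map_zero, FreeAlgebra.lift_ι_apply, repGen]
    ext1 p q
    fin_cases p <;> fin_cases q <;> simp
    · linear_combination C 2 * X ^ 2 * hij' - X ^ 2 * hC2
    · ring
    · ring
    · linear_combination C 2 * X ^ 2 * hij' - X ^ 2 * hC2
  | spow =>
    simp only [map_pow, map_one, FreeAlgebra.lift_ι_apply, repGen]
    ext1 p q
    fin_cases p <;> fin_cases q <;> simp [pow_succ]
    · linear_combination (C ω ^ 3 + 1) * hω3
    · linear_combination hω3
  | scomm i =>
    have hi : C ω ^ (i + 1).val = C ω ^ i.val * C ω := by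
      rw [← pow_succ, ZMod.val_add, ZMod.val_one, ← pow_mod_orderOf, Nat.mod_mod_of_dvd _
        (orderOf_dvd_of_pow_eq_one hω3), pow_mod_orderOf]
    simp only [map_mul, FreeAlgebra.lift_ι_apply, repGen]
    ext1 p q
    fin_cases p <;> fin_cases q <;> simp
    · ring
    · rw [hi]; ring
    · rw [pow_mul', pow_mul', hi]
      linear_combination (-C 2 * (C ω ^ i.val) ^ 2 * C ω * X) * hω3

/-- The representation of `A # C₃` on `k[X]²`. -/
noncomputable def skewRep {ω : k} (hω : 1 + ω + ω ^ 2 = 0) :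
    SkewGroup k 3 →ₐ[k] Matrix (Fin 2) (Fin 2) k[X] :=
  RingQuot.liftAlgHom k ⟨FreeAlgebra.lift k (repGen ω), repGen_rel hω⟩

lemma skewRep_xg {ω : k} (hω : 1 + ω + ω ^ 2 = 0) (i : ZMod 3) :
    skewRep hω (xg k 3 i) = repGen ω (.inl i) := by
  simp [skewRep, xg]

lemma skewRep_sg {ω : k} (hω : 1 + ω + ω ^ 2 = 0) :
    skewRep hω (sg k 3) = repGen ω (.inr ()) := by
  simp [skewRep, sg]

lemma skewRep_e0 {ω : k} (hω : 1 + ω + ω ^ 2 = 0) : skewRep hω (e0 k 3) = 0 := by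
  have hω' : 1 + C ω + C ω ^ 2 = 0 := by
    rw [← C_pow, ← C_1, ← C_add, ← C_add, hω, C_0]
  have h : 1 + repGen ω (.inr ()) + repGen ω (.inr ()) ^ 2 = 0 := by
    ext1 p q
    fin_cases p <;> fin_cases q <;> simp [repGen, pow_two]
    · linear_combination hω' + C ω * (C ω - 1) * hω'
    · linear_combination hω'
  rw [e0, map_smul, map_sum, Finset.sum_range_succ, Finset.sum_range_succ, Finset.sum_range_one,
    map_pow, map_pow, map_pow, skewRep_sg, pow_zero, pow_one, h, smul_zero]

/-- The representation of `E` on `k[X]²`, for `n = 3`. -/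
noncomputable def quotRep {ω : k} (hω : 1 + ω + ω ^ 2 = 0) :
    Equot k 3 →ₐ[k] Matrix (Fin 2) (Fin 2) k[X] :=
  RingQuot.liftAlgHom k ⟨skewRep hω, by
    rintro a b ⟨rfl, rfl⟩
    rw [skewRep_e0, map_zero]⟩

lemma quotRep_xE {ω : k} (hω : 1 + ω + ω ^ 2 = 0) (i : ZMod 3) :
    quotRep hω (xE k 3 i) = repGen ω (.inl i) := by
  rw [← skewRep_xg hω]
  simp [quotRep, xE]

lemma quotRep_sum_xE [CharZero k] {ω : k} (hω : 1 + ω + ω ^ 2 = 0) :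
    quotRep hω ((3⁻¹ : k) • (xE k 3 0 + xE k 3 1 + xE k 3 2)) = Matrix.diagonal ![X, -X] := by
  have hω' : 1 + C ω + C ω ^ 2 = 0 := by
    rw [← C_pow, ← C_1, ← C_add, ← C_add, hω, C_0]
  have h3 : (3 : k) ≠ 0 := by norm_num
  rw [map_smul, inv_smul_eq_iff₀ h3, map_add, map_add, quotRep_xE, quotRep_xE, quotRep_xE]
  ext1 p q
  have hC3 : (C 3 : k[X]) = 3 := map_ofNat C 3
  have h1 : (1 : ZMod 3).val = 1 := rfl
  have h2 : (2 : ZMod 3).val = 2 := rfl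
  fin_cases p <;> fin_cases q <;> simp [repGen, h1, h2, Algebra.smul_def]
  · linear_combination -X * hC3
  · linear_combination X * hω'
  · linear_combination (C 2 * X) * hω' + C 2 * X * C ω * (C ω - 1) * hω'
  · linear_combination X * hC3

lemma linearIndependent_diagonal_X_pow :
    LinearIndependent k fun i : ℕ =>
      (Matrix.diagonal ![X, -X] : Matrix (Fin 2) (Fin 2) k[X]) ^ i := by
  refine .of_comp (Matrix.entryLinearMap k k[X] (0 : Fin 2) (0 : Fin 2)) ?_
  convert (basisMonomials k).linearIndependent using 1
  ext1 i
  simp [Matrix.diagonal_pow, monomial_one_right_eq_X_pow]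

end Representation

section VgenGrowth

variable (k : Type*) [Field k] [CharZero k] {ω : k}

lemma one_add_sE_add_sq : 1 + sE k 3 + sE k 3 ^ 2 = 0 := by
  have h := sum_sE_pow k 3
  rwa [Finset.sum_range_succ, Finset.sum_range_succ, Finset.sum_range_one, pow_zero, pow_one] at h

lemma eigenRelations_E (hω : 1 + ω + ω ^ 2 = 0) :
    EigenRelations ω (sE k 3) (xE k 3 0 + xE k 3 1 + xE k 3 2)
      (xE k 3 0 + ω • xE k 3 1 + ω ^ 2 • xE k 3 2)
      (xE k 3 0 + ω ^ 2 • xE k 3 1 + ω • xE k 3 2) := by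
  have hω1 : ω ≠ 1 := by
    rintro rfl
    norm_num at hω
  exact eigenRelations_of_skew hω hω1 (xE_anti k 3) (one_add_sE_add_sq k) (sE_mul_xE k 3)

lemma finrank_Vgen_pow_le (hω : 1 + ω + ω ^ 2 = 0) (m : ℕ) :
    Module.finrank k (Vgen k 3 ^ m : Submodule k (Equot k 3)) ≤ 4 * (2 * m + 1) :=
  (eigenRelations_E k hω).finrank_pow_le (Vgen_three_le k hω) m

lemma le_finrank_Vgen_pow (hω : 1 + ω + ω ^ 2 = 0) (m : ℕ) :
    m + 1 ≤ Module.finrank k (Vgen k 3 ^ m : Submodule k (Equot k 3)) :=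
  finrank_pow_ge (B := Equot k 3) (V := Vgen k 3) (Vgen_fg k 3) (one_mem_Vgen k 3)
    (sum_xE_mem_Vgen k) (quotRep hω)
    (by simpa only [quotRep_sum_xE] using linearIndependent_diagonal_X_pow) m

end VgenGrowth

end NCIS

open NCIS in
/-- Proposition 4.1: for `n = 3`, `GKdim E = 1`; equivalently the
pertinency `p(A, C₃) = 3 − GKdim E` equals `2`. -/
theorem gkdim_skewGroup_quotient_three
    (k : Type*) [Field k] [IsAlgClosed k] [CharZero k] :
    gkdim k (Equot k 3) (Vgen k 3) = 1 ∧
      (3 : ℝ) - gkdim k (Equot k 3) (Vgen k 3) = 2 := by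
  obtain ⟨ω, hω⟩ : ∃ ω : k, 1 + ω + ω ^ 2 = 0 := by
    obtain ⟨z, hz⟩ := IsAlgClosed.exists_pow_nat_eq (-3 : k) two_pos
    exact ⟨(z - 1) / 2, by linear_combination hz / 4⟩
  have h : gkdim k (Equot k 3) (Vgen k 3) = 1 :=
    gkdim_eq_one_of_linear_growth 4 (le_finrank_Vgen_pow k hω) (finrank_Vgen_pow_le k hω)
  exact ⟨h, by rw [h]; norm_num⟩
end
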